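/- arXiv:1111.3388 — 3 statements merged into one kernel-verified Lean document; each statement's English description precedes it below -/
import Mathlib

section
/- Let α>0 with α≠1, s<0, t>0. Then for every point w in the tube domain T_{A_{α,s,t}} ⊂ ℂ² there exist a neighborhood U of w in T_{A_{α,s,t}} and a constant M>0 such that every holomorphic map f: Δ → T_{A_{α,s,t}} with f(0) ∈ U satisfies ‖f'(0)‖ < M. (This derivative-bound condition characterizes Kobayashi hyperbolicity of T_{A_{α,s,t}}.) -/
open Complex Metric Set Filter Topology

/-- The tube domain over a base `D ⊆ ℝ²`. -/
def tube (D : Set (ℝ × ℝ)) : Set (ℂ × ℂ) := {z | (z.1.re, z.2.re) ∈ D}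

/-- The base domain `A_{α,s,t}`: `x₂ > t·x₁^α` for `x₁ > 0`, `x₂ > 0` for `x₁ = 0`,
and `x₂ > s·(-x₁)^α` for `x₁ < 0`. -/
def setA (α s t : ℝ) : Set (ℝ × ℝ) :=
  {x | (0 < x.1 → t * x.1 ^ α < x.2) ∧ (x.1 = 0 → 0 < x.2) ∧
       (x.1 < 0 → s * (-x.1) ^ α < x.2)}


namespace TubeHyp

/-- The boundary function of `setA`. -/
noncomputable def phi (α s t x : ℝ) : ℝ := t * (max x 0) ^ α + s * (max (-x) 0) ^ α

lemma phi_nonneg_arg {α s t x : ℝ} (hα : 0 < α) (hx : 0 ≤ x) : phi α s t x = t * x ^ α := by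
  have h : max (-x) 0 = 0 := max_eq_right (by linarith)
  simp [phi, h, max_eq_left hx, Real.zero_rpow hα.ne']

lemma phi_nonpos_arg {α s t x : ℝ} (hα : 0 < α) (hx : x ≤ 0) :
    phi α s t x = s * (-x) ^ α := by
  have h : max (-x) 0 = -x := max_eq_left (by linarith)
  simp [phi, h, max_eq_right hx, Real.zero_rpow hα.ne']

lemma phi_continuous {α s t : ℝ} (hα : 0 < α) : Continuous (phi α s t) := by
  unfold phi
  have h1 : Continuous fun x : ℝ => (max x 0) ^ α :=
    (continuous_id.max continuous_const).rpow_const (fun _ => Or.inr hα.le)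
  have h2 : Continuous fun x : ℝ => (max (-x) 0) ^ α :=
    (continuous_neg.max continuous_const).rpow_const (fun _ => Or.inr hα.le)
  fun_prop

lemma mem_setA_iff {α s t : ℝ} (hα : 0 < α) (x : ℝ × ℝ) :
    x ∈ setA α s t ↔ phi α s t x.1 < x.2 := by
  simp only [setA, mem_ofPred_eq]
  rcases lt_trichotomy x.1 0 with h | h | h
  · rw [phi_nonpos_arg hα h.le]
    simp [h, h.ne, not_lt.2 h.le]
  · rw [phi_nonpos_arg hα h.le]
    simp [h, Real.zero_rpow hα.ne']
  · rw [phi_nonneg_arg hα h.le]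
    simp [h, h.ne', not_lt.2 h.le]

lemma phi_div {α s t x l : ℝ} (hl : 0 < l) : phi α s t (x / l) = phi α s t x / l ^ α := by
  have h1 : max (x / l) 0 = max x 0 / l := by
    rw [← max_div_div_right hl.le]; simp
  have h2 : max (-(x / l)) 0 = max (-x) 0 / l := by
    rw [← max_div_div_right hl.le]; simp [neg_div]
  unfold phi
  rw [h1, h2, Real.div_rpow (le_max_right _ _) hl.le, Real.div_rpow (le_max_right _ _) hl.le]
  ring

lemma phi_swap {α s t u v : ℝ} (hα : 0 < α) (hs : s < 0) (ht : 0 < t)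
    (h : phi α s t u < v) :
    phi (1/α) (-(1/t)^(1/α)) ((1/(-s))^(1/α)) (-v) < -u := by
  have hα' : 0 < 1/α := by positivity
  rcases le_or_gt 0 v with hv | hv
  · rw [phi_nonpos_arg hα' (by linarith), neg_neg, neg_mul, neg_lt_neg_iff,
      ← Real.mul_rpow (by positivity) hv]
    rcases le_or_gt 0 u with hu | hu
    · rw [phi_nonneg_arg hα hu] at h
      have h2 : u ^ α < 1/t * v := by
        rw [one_div, inv_mul_eq_div, lt_div_iff₀ ht]; linarith
      have := Real.rpow_lt_rpow (by positivity) h2 hα'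
      rwa [← Real.rpow_mul hu, mul_one_div_cancel hα.ne', Real.rpow_one] at this
    · exact hu.trans_le (by positivity)
  · have hu : u < 0 := by
      by_contra hu
      rw [phi_nonneg_arg hα (not_lt.1 hu)] at h
      have : 0 ≤ t * u ^ α := mul_nonneg ht.le (Real.rpow_nonneg (not_lt.1 hu) _)
      linarith
    have hs' : 0 < -s := by linarith
    rw [phi_nonneg_arg hα' (by linarith), ← Real.mul_rpow (by positivity) (by linarith)]
    rw [phi_nonpos_arg hα hu.le] at h
    have h2 : 1/(-s) * (-v) < (-u)^α := by
      rw [one_div, inv_mul_eq_div, div_lt_iff₀ hs']; linarith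
    have := Real.rpow_lt_rpow (mul_nonneg (by positivity) (by linarith)) h2 hα'
    rwa [← Real.rpow_mul (by linarith), mul_one_div_cancel hα.ne', Real.rpow_one] at this

/-- Entire functions with real part bounded above are constant. -/
lemma deriv_zero_of_re_le {g : ℂ → ℂ} (hg : Differentiable ℂ g) {B : ℝ}
    (h : ∀ z, (g z).re ≤ B) (z : ℂ) : deriv g z = 0 := by
  have h1 : Differentiable ℂ (fun z => Complex.exp (g z)) := hg.cexp
  have hb : Bornology.IsBounded (range fun z => Complex.exp (g z)) := by
    rw [isBounded_iff_forall_norm_le]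
    refine ⟨Real.exp B, ?_⟩
    rintro _ ⟨z, rfl⟩
    rw [Complex.norm_exp]
    exact Real.exp_le_exp.2 (h z)
  have h2 : (fun z => Complex.exp (g z)) = fun _ => Complex.exp (g 0) := by
    funext z
    exact h1.apply_eq_apply_of_bounded hb z 0
  have h3 : deriv (fun z => Complex.exp (g z)) z = 0 := by rw [h2]; simp
  rw [deriv_cexp (hg z)] at h3
  simpa using h3

lemma cap_bound {α s e : ℝ} (hα1 : α < 1) (hs : s < 0) (he : 0 < e) (hα : 0 < α) :
    ∃ C > 0, ∀ y : ℝ, 0 < y → (-s) * y ^ α - e * y ≤ C := by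
  have hs' : 0 < -s := by linarith
  set y0 : ℝ := (e / (-s)) ^ (1 / (α - 1)) with hy0
  have hq : 0 < e / (-s) := by positivity
  have hy0p : 0 < y0 := Real.rpow_pos_of_pos hq _
  have hk : y0 ^ (α - 1) = e / (-s) := by
    rw [hy0, ← Real.rpow_mul hq.le, one_div_mul_cancel (by linarith), Real.rpow_one]
  refine ⟨(-s) * y0 ^ α, by positivity, fun y hy => ?_⟩
  rcases le_total y y0 with h | h
  · have := Real.rpow_le_rpow hy.le h hα.le
    nlinarith [mul_pos he hy]
  · have h1 : y ^ (α - 1) ≤ e / (-s) := by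
      rw [← hk]; exact Real.rpow_le_rpow_of_nonpos hy0p h (by linarith)
    have h2 : y ^ α = y ^ (α - 1) * y := by
      rw [← Real.rpow_add_one hy.ne']; congr 1; ring
    have h3 : (-s) * y ^ (α - 1) ≤ e := by
      rw [le_div_iff₀ hs'] at h1; linarith
    have h4 : (-s) * y ^ α ≤ e * y := by
      rw [h2, ← mul_assoc]; exact mul_le_mul_of_nonneg_right h3 hy.le
    have : 0 ≤ (-s) * y0 ^ α := by positivity
    linarith

/-- Phragmen-Lindelof step: the maximum over the unit disc is a global maximum. -/
lemma pl_step {u l : ℂ → ℝ} (hu : Continuous u) {L : ℂ → ℂ} (hL : Differentiable ℂ L)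
    (hl : ∀ z, (L z).re = l z) (hul : ∀ z, u z = 0 → l z ≤ 0) {C M : ℝ} (hC : 0 < C)
    (hM : 0 ≤ M) (hb : ∀ z, u z ≤ 0 → l z ≤ C) (z0 : ℂ)
    (hmax : ∀ z, ‖z - z0‖ ≤ 1 → u z ≤ 0 → l z ≤ M) (z : ℂ) (hz : u z < 0) : l z ≤ M := by
  have hlc : Continuous l := by
    have : l = fun z => (L z).re := funext fun z => (hl z).symm
    rw [this]; exact Complex.continuous_re.comp hL.continuous
  by_cases hz1 : ‖z - z0‖ ≤ 1
  · exact hmax z hz1 hz.le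
  push Not at hz1
  by_cases hlz : l z ≤ 0
  · linarith
  push Not at hlz
  have key : ∀ N : ℝ, 0 < N → ‖z - z0‖ < Real.exp (N * C) →
      N * l z ≤ N * M + Real.log ‖z - z0‖ := by
    intro N hN hzR
    set W : Set ℂ := {x | u x < 0 ∧ 0 < l x ∧ 1 < ‖x - z0‖ ∧ ‖x - z0‖ < Real.exp (N * C)}
      with hW
    have hWo : IsOpen W := by
      have h1 := (isOpen_lt hu (continuous_const (y := (0:ℝ)))).inter
        (isOpen_lt (continuous_const (y := (0:ℝ))) hlc)
      have hn : Continuous fun x : ℂ => ‖x - z0‖ := by fun_prop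
      have h2 := (isOpen_lt (continuous_const (y := (1:ℝ))) hn).inter
        (isOpen_lt hn (continuous_const (y := Real.exp (N * C))))
      convert h1.inter h2 using 1
      ext x; simp [hW, and_assoc]
    have hcl : closure W ⊆ {x | u x ≤ 0 ∧ 0 ≤ l x ∧ 1 ≤ ‖x - z0‖ ∧
        ‖x - z0‖ ≤ Real.exp (N * C)} := by
      apply closure_minimal
      · rintro x ⟨a, b, c, d⟩; exact ⟨a.le, b.le, c.le, d.le⟩
      · have hn : Continuous fun x : ℂ => ‖x - z0‖ := by fun_prop
        have h1 := (isClosed_le hu (continuous_const (y := (0:ℝ)))).inter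
          (isClosed_le (continuous_const (y := (0:ℝ))) hlc)
        have h2 := (isClosed_le (continuous_const (y := (1:ℝ))) hn).inter
          (isClosed_le hn (continuous_const (y := Real.exp (N * C))))
        convert h1.inter h2 using 1
        ext x; simp [and_assoc]
    have hne : ∀ x ∈ closure W, x - z0 ≠ 0 := by
      intro x hx h0
      have := (hcl hx).2.2.1
      rw [h0, norm_zero] at this
      linarith
    have hnorm : ∀ x, ‖Complex.exp (N * L x) / (x - z0)‖ = Real.exp (N * l x) / ‖x - z0‖ := by
      intro x
      rw [norm_div, Complex.norm_exp, Complex.re_ofReal_mul, hl]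
    have hd : DiffContOnCl ℂ (fun x => Complex.exp (N * L x) / (x - z0)) W := by
      apply DifferentiableOn.diffContOnCl
      intro x hx
      have := hne x hx
      apply DifferentiableAt.differentiableWithinAt
      have h3 := hL x
      fun_prop (disch := assumption)
    have hbd : Bornology.IsBounded W := by
      apply (isBounded_ball (x := z0) (r := Real.exp (N * C))).subset
      rintro x ⟨-, -, -, h⟩
      rwa [mem_ball, dist_eq_norm]
    have hfr : ∀ x ∈ frontier W, ‖Complex.exp (N * L x) / (x - z0)‖ ≤ Real.exp (N * M) := by
      intro x hx
      rw [hWo.frontier_eq] at hx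
      obtain ⟨hx1, hx2⟩ := hx
      obtain ⟨a, b, c, d⟩ := hcl hx1
      rw [hnorm, div_le_iff₀ (by linarith)]
      have hE : 1 ≤ Real.exp (N * M) := Real.one_le_exp (by positivity)
      by_cases ha : l x ≤ M
      · have h5 : Real.exp (N * l x) ≤ Real.exp (N * M) :=
          Real.exp_le_exp.2 (mul_le_mul_of_nonneg_left ha hN.le)
        nlinarith
      · have h6 : u x < 0 := lt_of_le_of_ne a fun h => ha ((hul x h).trans hM)
        have h7 : 1 < ‖x - z0‖ := lt_of_le_of_ne c fun h => ha (hmax x h.symm.le a)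
        have h8 : ‖x - z0‖ = Real.exp (N * C) := by
          by_contra h
          exact hx2 ⟨h6, by linarith, h7, lt_of_le_of_ne d h⟩
        rw [h8]
        have h5 : Real.exp (N * l x) ≤ Real.exp (N * C) :=
          Real.exp_le_exp.2 (mul_le_mul_of_nonneg_left (hb x a) hN.le)
        nlinarith [Real.exp_pos (N * C)]
    have := Complex.norm_le_of_forall_mem_frontier_norm_le hbd hd hfr
      (subset_closure (show z ∈ W from ⟨hz, hlz, hz1, hzR⟩))
    rw [hnorm, div_le_iff₀ (by linarith)] at this
    have h9 := Real.log_le_log (Real.exp_pos _) this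
    rwa [Real.log_mul (Real.exp_pos _).ne' (by linarith), Real.log_exp, Real.log_exp] at h9
  by_contra hcon
  push Not at hcon
  set N : ℝ := (Real.log ‖z - z0‖ + 1) * (1 / C + 1 / (l z - M)) with hN
  have hlog : 0 < Real.log ‖z - z0‖ := Real.log_pos hz1
  have hd : 0 < l z - M := by linarith
  have hNp : 0 < N := by positivity
  have h1 : Real.log ‖z - z0‖ < N * C := by
    have : N * C = (Real.log ‖z - z0‖ + 1) * (1 + C / (l z - M)) := by
      rw [hN]; field_simp
    rw [this]
    have : 0 < C / (l z - M) := by positivity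
    nlinarith
  have h2 : Real.log ‖z - z0‖ < N * (l z - M) := by
    have : N * (l z - M) = (Real.log ‖z - z0‖ + 1) * ((l z - M) / C + 1) := by
      rw [hN]; field_simp
    rw [this]
    have : 0 < (l z - M) / C := by positivity
    nlinarith
  have h3 : ‖z - z0‖ < Real.exp (N * C) := by
    rwa [← Real.log_lt_iff_lt_exp (by linarith)]
  have := key N hNp h3
  nlinarith

lemma liouville {α s t : ℝ} (hα : 0 < α) (hα1 : α < 1) (hs : s < 0) (ht : 0 < t)
    {g1 g2 : ℂ → ℂ} (h1 : Differentiable ℂ g1) (h2 : Differentiable ℂ g2)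
    (h : ∀ z, phi α s t (g1 z).re ≤ (g2 z).re) (z : ℂ) : deriv g1 z = 0 ∧ deriv g2 z = 0 := by
  have hpos : ∀ z, 0 ≤ (g1 z).re → 0 ≤ (g2 z).re := by
    intro z hz
    refine le_trans ?_ (h z)
    rw [phi_nonneg_arg hα hz]; positivity
  by_cases hv : ∀ z, 0 ≤ (g2 z).re
  · have hd2 : ∀ z, deriv g2 z = 0 := by
      intro z
      have := deriv_zero_of_re_le h2.neg (B := 0) (fun z => by simpa using hv z) z
      rw [deriv.neg] at this
      simpa using this
    refine ⟨?_, hd2 z⟩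
    have hc : ∀ z, g2 z = g2 0 := fun z => is_const_of_deriv_eq_zero h2 hd2 z 0
    refine deriv_zero_of_re_le h1 (B := ((g2 0).re / t) ^ (1/α)) (fun z => ?_) z
    rcases le_or_gt (g1 z).re 0 with hz | hz
    · exact hz.trans (Real.rpow_nonneg (div_nonneg (hv 0) ht.le) _)
    · have := h z
      rw [phi_nonneg_arg hα hz.le, hc z] at this
      have h3 : (g1 z).re ^ α ≤ (g2 0).re / t := by rw [le_div_iff₀ ht]; linarith
      have h4 := Real.rpow_le_rpow (Real.rpow_nonneg hz.le _) h3 (one_div_pos.2 hα).le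
      rwa [← Real.rpow_mul hz.le, mul_one_div_cancel hα.ne', Real.rpow_one] at h4
  · push Not at hv
    obtain ⟨z0, hz0⟩ := hv
    have hu0 : (g1 z0).re < 0 := by
      by_contra hc
      linarith [hpos z0 (not_lt.1 hc)]
    set e : ℝ := (g2 z0).re / (2 * (g1 z0).re) with he
    have hep : 0 < e := div_pos_of_neg_of_neg hz0 (by linarith)
    obtain ⟨C, hC, hCb⟩ := cap_bound hα1 hs hep hα
    set L : ℂ → ℂ := fun z => e * g1 z - g2 z with hLdef
    have hL : Differentiable ℂ L := (h1.const_mul _).sub h2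
    set l : ℂ → ℝ := fun z => e * (g1 z).re - (g2 z).re with hldef
    have hl : ∀ z, (L z).re = l z := fun z => by simp [hLdef, hldef]
    have hu : Continuous fun z => (g1 z).re := Complex.continuous_re.comp h1.continuous
    have hv : Continuous fun z => (g2 z).re := Complex.continuous_re.comp h2.continuous
    have hlc : Continuous l := by fun_prop
    have hul : ∀ z, (g1 z).re = 0 → l z ≤ 0 := by
      intro z hz
      have := hpos z hz.ge
      simp only [hldef, hz]; linarith
    have hl0 : 0 < l z0 := by
      have : e * (g1 z0).re = (g2 z0).re / 2 := by
        have := hu0.ne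
        rw [he]; field_simp
      simp only [hldef, this]; linarith
    have hbC : ∀ z, (g1 z).re ≤ 0 → l z ≤ C := by
      intro z hz
      rcases hz.lt_or_eq with hz' | hz'
      · have h5 := hCb (-(g1 z).re) (by linarith)
        have h6 := h z
        rw [phi_nonpos_arg hα hz] at h6
        simp only [hldef]; linarith
      · linarith [hul z hz']
    have hcomp : IsCompact (closedBall z0 1 ∩ {z | (g1 z).re ≤ 0}) :=
      (isCompact_closedBall z0 1).inter_right (isClosed_le hu continuous_const)
    obtain ⟨p, ⟨hp1, hp2⟩, hpm⟩ := hcomp.exists_isMaxOn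
      ⟨z0, mem_closedBall_self zero_le_one, hu0.le⟩ hlc.continuousOn
    have hlp : 0 < l p := hl0.trans_le (hpm ⟨mem_closedBall_self zero_le_one, hu0.le⟩)
    have hup : (g1 p).re < 0 := lt_of_le_of_ne hp2 fun hh => by linarith [hul p hh]
    have hglob : ∀ z, (g1 z).re < 0 → l z ≤ l p :=
      pl_step hu hL hl hul hC hlp.le hbC z0 (fun z hz1 hz2 =>
        hpm ⟨by rwa [mem_closedBall, dist_eq_norm], hz2⟩)
    have hEd : Differentiable ℂ fun z => Complex.exp (L z) := hL.cexp
    have hloc : IsLocalMax (norm ∘ fun z => Complex.exp (L z)) p := by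
      filter_upwards [(isOpen_lt hu (continuous_const (y := (0:ℝ)))).mem_nhds hup] with z hz
      simp only [Function.comp, Complex.norm_exp, hl]
      exact Real.exp_le_exp.2 (hglob z hz)
    have hev := Complex.eventually_eq_of_isLocalMax_norm
      (Eventually.of_forall fun z => hEd z) hloc
    have hconst : (fun z => Complex.exp (L z)) = fun _ => Complex.exp (L p) :=
      AnalyticOnNhd.eq_of_eventuallyEq (𝕜 := ℂ) (z₀ := p)
        (fun z _ => hEd.analyticAt z) (fun z _ => analyticAt_const) hev
    have hlconst : ∀ z, l z = l p := by
      intro z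
      have := congrArg norm (congrFun hconst z)
      simpa only [Complex.norm_exp, hl, Real.exp_eq_exp] using this
    have hneg : ∀ z, (g1 z).re ≤ 0 := by
      intro z
      by_contra hz
      push Not at hz
      obtain ⟨y, hy⟩ := mem_range_of_exists_le_of_exists_ge hu ⟨p, hup.le⟩ ⟨z, hz.le⟩
      have := hul y hy
      linarith [hlconst y]
    have hd1 : ∀ z, deriv g1 z = 0 := deriv_zero_of_re_le h1 hneg
    refine ⟨hd1 z, ?_⟩
    refine deriv_zero_of_re_le h2 (B := e * (g1 0).re - l p) (fun z => ?_) z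
    have h7 := hlconst z
    simp only [hldef] at h7 ⊢
    rw [is_const_of_deriv_eq_zero h1 hd1 z 0] at h7
    linarith

/-- Quasi-homogeneous size function. -/
noncomputable def nrg (α x y : ℝ) : ℝ := x ^ 2 + |y| ^ (2 / α)

lemma nrg_nonneg (α x y : ℝ) : 0 ≤ nrg α x y := by unfold nrg; positivity

lemma abs_le_nrg_left (α x y : ℝ) : |x| ≤ nrg α x y ^ (1 / 2 : ℝ) := by
  rw [← Real.sqrt_eq_rpow]
  apply Real.abs_le_sqrt
  unfold nrg
  have : 0 ≤ |y| ^ (2 / α) := by positivity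
  linarith

lemma abs_le_nrg_right {α : ℝ} (hα : 0 < α) (x y : ℝ) : |y| ≤ nrg α x y ^ (α / 2) := by
  have h1 : |y| ^ (2 / α) ≤ nrg α x y := by
    unfold nrg; nlinarith [sq_nonneg x]
  have h2 := Real.rpow_le_rpow (by positivity) h1 (show 0 ≤ α / 2 by positivity)
  rwa [← Real.rpow_mul (abs_nonneg y), show 2 / α * (α / 2) = 1 by field_simp,
    Real.rpow_one] at h2

lemma nrg_div {α : ℝ} (hα : 0 < α) (x y : ℝ) {l : ℝ} (hl : 0 < l) :
    nrg α (x / l) (y / l ^ α) = nrg α x y / l ^ 2 := by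
  unfold nrg
  have h : |y / l ^ α| ^ (2 / α) = |y| ^ (2 / α) / l ^ 2 := by
    rw [abs_div, abs_of_pos (Real.rpow_pos_of_pos hl α),
      Real.div_rpow (abs_nonneg y) (by positivity), ← Real.rpow_mul hl.le,
      show α * (2 / α) = (2 : ℕ) by push_cast; field_simp, Real.rpow_natCast]
  rw [h]; ring

lemma nrg_pos {α s t : ℝ} (hα : 0 < α) {x y : ℝ} (h : phi α s t x < y) :
    0 < nrg α x y := by
  unfold nrg
  by_cases hx : x = 0
  · subst hx
    rw [phi_nonneg_arg hα le_rfl, Real.zero_rpow hα.ne', mul_zero] at h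
    have : 0 < |y| ^ (2 / α) := Real.rpow_pos_of_pos (abs_pos.2 h.ne') _
    positivity
  · positivity

lemma nrg_continuous {α : ℝ} (hα : 0 < α) : Continuous fun p : ℝ × ℝ => nrg α p.1 p.2 := by
  unfold nrg
  have : Continuous fun p : ℝ × ℝ => |p.2| ^ (2 / α) :=
    continuous_snd.abs.rpow_const fun _ => Or.inr (by positivity)
  fun_prop

lemma growth {α : ℝ} (hα : 0 < α) (hα1 : α < 1) {g1 g2 : ℂ → ℂ} {R : ℝ}
    (d1 : DifferentiableOn ℂ g1 (ball 0 R)) (d2 : DifferentiableOn ℂ g2 (ball 0 R))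
    (b1 : ∀ z ∈ ball (0:ℂ) R, ‖deriv g1 z‖ ≤ 2 * nrg α (g1 z).re (g2 z).re ^ (1 / 2 : ℝ))
    (b2 : ∀ z ∈ ball (0:ℂ) R, ‖deriv g2 z‖ ≤ 2 * nrg α (g1 z).re (g2 z).re ^ (α / 2))
    (h0 : nrg α (g1 0).re (g2 0).re = 1) (z : ℂ) (hz : z ∈ ball (0:ℂ) R) :
    nrg α (g1 z).re (g2 z).re ≤ Real.exp ((4 + 4 / α) * ‖z‖) := by
  have hmem : ∀ τ ∈ Icc (0:ℝ) 1, (τ : ℂ) * z ∈ ball (0:ℂ) R := by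
    intro τ hτ
    rw [mem_ball_zero_iff] at hz ⊢
    rw [norm_mul, Complex.norm_real, Real.norm_eq_abs, abs_of_nonneg hτ.1]
    nlinarith [norm_nonneg z, hτ.2]
  have hp : 1 < 2 / α := by rw [lt_div_iff₀ hα]; linarith
  have hcurve : ∀ g : ℂ → ℂ, DifferentiableOn ℂ g (ball 0 R) → ∀ τ ∈ Icc (0:ℝ) 1,
      HasDerivAt (fun x : ℝ => (g (x * z)).re) (deriv g (τ * z) * z).re τ := by
    intro g hg τ hτ
    have h1 : HasDerivAt g (deriv g (τ * z)) (τ * z) :=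
      (hg.differentiableAt (isOpen_ball.mem_nhds (hmem τ hτ))).hasDerivAt
    have h2 : HasDerivAt (fun w : ℂ => w * z) z (τ : ℂ) := by
      simpa using (hasDerivAt_id (τ : ℂ)).mul_const z
    exact (HasDerivAt.comp (τ : ℂ) h1 h2).real_of_complex
  set E : ℝ → ℝ := fun τ => nrg α (g1 (τ * z)).re (g2 (τ * z)).re with hE
  set E' : ℝ → ℝ := fun τ => 2 * (g1 (τ * z)).re * (deriv g1 (τ * z) * z).re +
    (2 / α * |(g2 (τ * z)).re| ^ (2 / α - 2) * (g2 (τ * z)).re) * (deriv g2 (τ * z) * z).re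
    with hE'
  have hder : ∀ τ ∈ Icc (0:ℝ) 1, HasDerivAt E (E' τ) τ := by
    intro τ hτ
    have h1 := (hcurve g1 d1 τ hτ).pow 2
    have h2 := HasDerivAt.comp τ (hasDerivAt_abs_rpow (g2 (τ * z)).re hp) (hcurve g2 d2 τ hτ)
    have h3 := h1.add h2
    have h4 : E' τ = ((2:ℕ):ℝ) * (g1 (τ * z)).re ^ (2 - 1) * (deriv g1 (τ * z) * z).re +
        (2 / α * |(g2 (τ * z)).re| ^ (2 / α - 2) * (g2 (τ * z)).re) *
          (deriv g2 (τ * z) * z).re := by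
      simp [hE']
    rw [h4]
    exact h3
  have hbound : ∀ τ ∈ Ico (0:ℝ) 1, ‖E' τ‖ ≤ ((4 + 4 / α) * ‖z‖) * ‖E τ‖ + 0 := by
    intro τ hτ
    have hτ' : τ ∈ Icc (0:ℝ) 1 := ⟨hτ.1, hτ.2.le⟩
    have hm := hmem τ hτ'
    have c1 := b1 _ hm
    have c2 := b2 _ hm
    have a1 := abs_le_nrg_left α (g1 (τ * z)).re (g2 (τ * z)).re
    have a2 := abs_le_nrg_right hα (g1 (τ * z)).re (g2 (τ * z)).re
    have hEn : 0 ≤ E τ := nrg_nonneg _ _ _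
    change _ ≤ 2 * (E τ) ^ (1 / 2 : ℝ) at c1
    change _ ≤ 2 * (E τ) ^ (α / 2) at c2
    change _ ≤ (E τ) ^ (1 / 2 : ℝ) at a1
    change _ ≤ (E τ) ^ (α / 2) at a2
    rw [Real.norm_of_nonneg hEn, Real.norm_eq_abs]
    have r1 : |(deriv g1 (τ * z) * z).re| ≤ 2 * (E τ) ^ (1 / 2 : ℝ) * ‖z‖ := by
      refine (Complex.abs_re_le_norm _).trans ?_
      rw [norm_mul]; gcongr
    have r2 : |(deriv g2 (τ * z) * z).re| ≤ 2 * (E τ) ^ (α / 2) * ‖z‖ := by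
      refine (Complex.abs_re_le_norm _).trans ?_
      rw [norm_mul]; gcongr
    have q1 : (E τ) ^ (1 / 2 : ℝ) * (E τ) ^ (1 / 2 : ℝ) = E τ := by
      rw [← Real.sqrt_eq_rpow]; exact Real.mul_self_sqrt hEn
    have q2 : |(g2 (τ * z)).re| ^ (2 / α - 2) * |(g2 (τ * z)).re| =
        |(g2 (τ * z)).re| ^ (2 / α - 1) := by
      rw [show 2 / α - 1 = (2 / α - 2) + 1 by ring, Real.rpow_add_one' (abs_nonneg _)]
      linarith
    have q3 : |(g2 (τ * z)).re| ^ (2 / α - 1) ≤ (E τ) ^ (1 - α / 2) := by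
      have := Real.rpow_le_rpow (abs_nonneg _) a2 (show 0 ≤ 2 / α - 1 by linarith)
      rwa [← Real.rpow_mul hEn, show α / 2 * (2 / α - 1) = 1 - α / 2 by field_simp] at this
    have q4 : (E τ) ^ (1 - α / 2) * (E τ) ^ (α / 2) = E τ := by
      rw [← Real.rpow_add' hEn (by norm_num)]; norm_num
    have t1 : |2 * (g1 (τ * z)).re * (deriv g1 (τ * z) * z).re| ≤ 4 * ‖z‖ * E τ := by
      rw [abs_mul, abs_mul, abs_two]
      calc 2 * |(g1 (τ * z)).re| * |(deriv g1 (τ * z) * z).re|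
          ≤ 2 * (E τ) ^ (1 / 2 : ℝ) * (2 * (E τ) ^ (1 / 2 : ℝ) * ‖z‖) := by gcongr
        _ = 4 * ‖z‖ * ((E τ) ^ (1 / 2 : ℝ) * (E τ) ^ (1 / 2 : ℝ)) := by ring
        _ = _ := by rw [q1]
    have t2 : |(2 / α * |(g2 (τ * z)).re| ^ (2 / α - 2) * (g2 (τ * z)).re) *
        (deriv g2 (τ * z) * z).re| ≤ 4 / α * ‖z‖ * E τ := by
      rw [abs_mul, abs_mul, abs_mul, abs_of_pos (show 0 < 2 / α by positivity),
        abs_of_nonneg (Real.rpow_nonneg (abs_nonneg _) _), mul_assoc (2 / α), q2]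
      calc 2 / α * |(g2 (τ * z)).re| ^ (2 / α - 1) * |(deriv g2 (τ * z) * z).re|
          ≤ 2 / α * (E τ) ^ (1 - α / 2) * (2 * (E τ) ^ (α / 2) * ‖z‖) := by gcongr
        _ = 4 / α * ‖z‖ * ((E τ) ^ (1 - α / 2) * (E τ) ^ (α / 2)) := by ring
        _ = _ := by rw [q4]
    refine (abs_add_le _ _).trans ?_
    linarith
  have hfin := norm_le_gronwallBound_of_norm_deriv_right_le (f := E) (f' := E') (δ := 1)
    (fun τ hτ => (hder τ hτ).continuousAt.continuousWithinAt)
    (fun τ hτ => (hder τ ⟨hτ.1, hτ.2.le⟩).hasDerivWithinAt)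
    (by simp [hE, h0]) hbound 1 ⟨zero_le_one, le_rfl⟩
  rw [gronwallBound_ε0] at hfin
  simp only [sub_zero, mul_one, one_mul] at hfin
  have := (le_abs_self (E 1)).trans hfin
  simpa [hE] using this

/-- Brody-type rescaling. -/
lemma brody {α s t : ℝ} (hα : 0 < α) {f1 f2 : ℂ → ℂ}
    (d1 : DifferentiableOn ℂ f1 (ball 0 1)) (d2 : DifferentiableOn ℂ f2 (ball 0 1))
    (hA : ∀ z ∈ ball (0:ℂ) 1, phi α s t (f1 z).re < (f2 z).re) {R : ℝ} (hR : 0 < R)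
    (hbig : 4 * R ≤ ‖deriv f1 0‖ / nrg α (f1 0).re (f2 0).re ^ (1 / 2 : ℝ) +
      ‖deriv f2 0‖ / nrg α (f1 0).re (f2 0).re ^ (α / 2)) :
    ∃ g1 g2 : ℂ → ℂ, DifferentiableOn ℂ g1 (ball 0 R) ∧ DifferentiableOn ℂ g2 (ball 0 R) ∧
      (∀ z ∈ ball (0:ℂ) R, phi α s t (g1 z).re < (g2 z).re) ∧
      (∀ z ∈ ball (0:ℂ) R, ‖deriv g1 z‖ ≤ 2 * nrg α (g1 z).re (g2 z).re ^ (1 / 2 : ℝ)) ∧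
      (∀ z ∈ ball (0:ℂ) R, ‖deriv g2 z‖ ≤ 2 * nrg α (g1 z).re (g2 z).re ^ (α / 2)) ∧
      nrg α (g1 0).re (g2 0).re = 1 ∧ (g1 0).im = 0 ∧ (g2 0).im = 0 ∧
      ‖deriv g1 0‖ + ‖deriv g2 0‖ = 1 := by
  set E : ℂ → ℝ := fun z => nrg α (f1 z).re (f2 z).re with hE
  set m : ℂ → ℝ := fun z => ‖deriv f1 z‖ / E z ^ (1 / 2 : ℝ) + ‖deriv f2 z‖ / E z ^ (α / 2)
    with hm
  have hEpos : ∀ z ∈ ball (0:ℂ) 1, 0 < E z := fun z hz => nrg_pos hα (hA z hz)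
  have hsub : closedBall (0:ℂ) (1/2) ⊆ ball 0 1 := closedBall_subset_ball (by norm_num)
  have hEc : ContinuousOn E (ball 0 1) := by
    have h1 : ContinuousOn (fun z => ((f1 z).re, (f2 z).re)) (ball (0:ℂ) 1) :=
      (Complex.continuous_re.comp_continuousOn d1.continuousOn).prodMk
        (Complex.continuous_re.comp_continuousOn d2.continuousOn)
    exact (nrg_continuous hα).comp_continuousOn h1
  have hmc : ContinuousOn m (ball 0 1) := by
    have e1 := (d1.deriv isOpen_ball).continuousOn.norm
    have e2 := (d2.deriv isOpen_ball).continuousOn.norm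
    have p1 : ContinuousOn (fun z => E z ^ (1 / 2 : ℝ)) (ball 0 1) :=
      hEc.rpow_const fun z hz => Or.inl (hEpos z hz).ne'
    have p2 : ContinuousOn (fun z => E z ^ (α / 2)) (ball 0 1) :=
      hEc.rpow_const fun z hz => Or.inl (hEpos z hz).ne'
    exact (e1.div p1 fun z hz => (Real.rpow_pos_of_pos (hEpos z hz) _).ne').add
      (e2.div p2 fun z hz => (Real.rpow_pos_of_pos (hEpos z hz) _).ne')
  have hHc : ContinuousOn (fun z : ℂ => (1/2 - ‖z‖) * m z) (closedBall 0 (1/2)) :=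
    (continuousOn_const.sub continuous_norm.continuousOn).mul (hmc.mono hsub)
  obtain ⟨p, hp, hpm⟩ := (isCompact_closedBall (0:ℂ) (1/2)).exists_isMaxOn
    ⟨0, mem_closedBall_self (by norm_num)⟩ hHc
  have hH0 : 2 * R ≤ (1/2 - ‖p‖) * m p := by
    have h1 : (1/2 - ‖(0:ℂ)‖) * m 0 ≤ (1/2 - ‖p‖) * m p :=
      hpm (mem_closedBall_self (by norm_num))
    have h2 : 4 * R ≤ m 0 := hbig
    rw [norm_zero] at h1
    linarith
  have hp1 := hsub hp
  have hp2 : ‖p‖ ≤ 1/2 := by simpa using hp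
  have hmp : 0 < m p := by
    by_contra hc
    nlinarith
  have hpd : 0 < 1/2 - ‖p‖ := by
    rcases hp2.lt_or_eq with h | h
    · linarith
    · rw [h] at hH0; linarith
  set a : ℝ := (m p)⁻¹ with ha
  have hap : 0 < a := inv_pos.2 hmp
  have hRa : R * a ≤ (1/2 - ‖p‖) / 2 := by
    rw [ha, ← div_eq_mul_inv, div_le_iff₀ hmp]; linarith
  have hzp : ∀ z ∈ ball (0:ℂ) R, ‖p + a * z‖ ≤ ‖p‖ + (1/2 - ‖p‖) / 2 := by
    intro z hz
    rw [mem_ball_zero_iff] at hz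
    refine (norm_add_le _ _).trans ?_
    rw [norm_mul, Complex.norm_real, Real.norm_of_nonneg hap.le]
    nlinarith
  have hzb : ∀ z ∈ ball (0:ℂ) R, p + a * z ∈ ball (0:ℂ) 1 := by
    intro z hz
    rw [mem_ball_zero_iff]
    linarith [hzp z hz]
  have hmz : ∀ z ∈ ball (0:ℂ) R, m (p + a * z) ≤ 2 * m p := by
    intro z hz
    have h1 := hzp z hz
    have h2 : (1/2 - ‖p + a * z‖) * m (p + a * z) ≤ (1/2 - ‖p‖) * m p :=
      hpm (by rw [mem_closedBall_zero_iff]; linarith)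
    have h3 : (1/2 - ‖p‖) / 2 ≤ 1/2 - ‖p + a * z‖ := by linarith
    have h4 : 0 ≤ m (p + a * z) := by
      have := (hEpos _ (hzb z hz)).le
      simp only [hm]; positivity
    have h5 : (1/2 - ‖p‖) / 2 * m (p + a * z) ≤ (1/2 - ‖p‖) * m p :=
      (mul_le_mul_of_nonneg_right h3 h4).trans h2
    by_contra hc
    push Not at hc
    nlinarith
  set l : ℝ := E p ^ (1 / 2 : ℝ) with hl
  have hEp := hEpos p hp1
  have hlp : 0 < l := Real.rpow_pos_of_pos hEp _
  have hl2 : l ^ 2 = E p := by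
    rw [hl, ← Real.sqrt_eq_rpow]; exact Real.sq_sqrt hEp.le
  have hla : l ^ α = E p ^ (α / 2) := by
    rw [hl, ← Real.rpow_mul hEp.le]; congr 1; ring
  have hlap : 0 < l ^ α := Real.rpow_pos_of_pos hlp _
  have hcomp : ∀ (f : ℂ → ℂ) (c : ℂ) (b : ℝ), DifferentiableOn ℂ f (ball 0 1) →
      ∀ z ∈ ball (0:ℂ) R, HasDerivAt (fun z => (f (p + a * z) - c) / (b:ℂ))
        (deriv f (p + a * z) * a / b) z := by
    intro f c b hf z hz
    have h1 : HasDerivAt f (deriv f (p + a * z)) (p + a * z) :=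
      (hf.differentiableAt (isOpen_ball.mem_nhds (hzb z hz))).hasDerivAt
    have h2 : HasDerivAt (fun w : ℂ => p + a * w) a z := by
      simpa using ((hasDerivAt_id z).const_mul (a:ℂ)).const_add p
    exact ((HasDerivAt.comp z h1 h2).sub_const c).div_const (b:ℂ)
  have hnorm : ∀ (f : ℂ → ℂ) (b : ℝ) (z : ℂ), 0 < b → ‖deriv f (p + a * z) * a / b‖ =
      ‖deriv f (p + a * z)‖ * a / b := by
    intro f b z hb
    rw [norm_div, norm_mul, Complex.norm_real, Complex.norm_real, Real.norm_of_nonneg hap.le,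
      Real.norm_of_nonneg hb.le]
  set g1 : ℂ → ℂ := fun z => (f1 (p + a * z) - ((f1 p).im * I)) / (l:ℂ) with hg1
  set g2 : ℂ → ℂ := fun z => (f2 (p + a * z) - ((f2 p).im * I)) / ((l ^ α : ℝ):ℂ) with hg2
  have k1 := hcomp f1 ((f1 p).im * I) l d1
  have k2 := hcomp f2 ((f2 p).im * I) (l ^ α) d2
  have re1 : ∀ z, (g1 z).re = (f1 (p + a * z)).re / l := by
    intro z; simp [hg1, Complex.div_ofReal_re]
  have re2 : ∀ z, (g2 z).re = (f2 (p + a * z)).re / l ^ α := by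
    intro z; simp only [hg2, Complex.div_ofReal_re]; simp
  have hn : ∀ z, nrg α (g1 z).re (g2 z).re = E (p + a * z) / E p := by
    intro z
    rw [re1, re2, nrg_div hα _ _ hlp, hl2]
  have z0 : (0:ℂ) ∈ ball (0:ℂ) R := mem_ball_self hR
  have hsplit : ∀ z ∈ ball (0:ℂ) R,
      ‖deriv f1 (p + a * z)‖ ≤ 2 * m p * E (p + a * z) ^ (1 / 2 : ℝ) ∧
      ‖deriv f2 (p + a * z)‖ ≤ 2 * m p * E (p + a * z) ^ (α / 2) := by
    intro z hz
    have h1 := hmz z hz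
    have h2 := hEpos _ (hzb z hz)
    have n1 : 0 ≤ ‖deriv f1 (p + a * z)‖ / E (p + a * z) ^ (1 / 2 : ℝ) := by positivity
    have n2 : 0 ≤ ‖deriv f2 (p + a * z)‖ / E (p + a * z) ^ (α / 2) := by positivity
    have h3 : ‖deriv f1 (p + a * z)‖ / E (p + a * z) ^ (1 / 2 : ℝ) +
      ‖deriv f2 (p + a * z)‖ / E (p + a * z) ^ (α / 2) ≤ 2 * m p := h1
    constructor
    · rw [← div_le_iff₀ (by positivity)]; linarith
    · rw [← div_le_iff₀ (by positivity)]; linarith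
  have hma : m p * a = 1 := mul_inv_cancel₀ hmp.ne'
  refine ⟨g1, g2, fun z hz => (k1 z hz).differentiableAt.differentiableWithinAt,
    fun z hz => (k2 z hz).differentiableAt.differentiableWithinAt, ?_, ?_, ?_, ?_, ?_, ?_, ?_⟩
  · intro z hz
    rw [re1, re2, phi_div hlp]
    exact div_lt_div_of_pos_right (hA _ (hzb z hz)) hlap
  · intro z hz
    rw [(k1 z hz).deriv, hnorm f1 l z hlp, hn, Real.div_rpow (hEpos _ (hzb z hz)).le hEp.le,
      ← hl, ← mul_div_assoc]
    refine div_le_div_of_nonneg_right ?_ hlp.le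
    calc ‖deriv f1 (p + a * z)‖ * a ≤ 2 * m p * E (p + a * z) ^ (1 / 2 : ℝ) * a := by
          gcongr; exact (hsplit z hz).1
      _ = 2 * (m p * a) * E (p + a * z) ^ (1 / 2 : ℝ) := by ring
      _ = _ := by rw [hma, mul_one]
  · intro z hz
    rw [(k2 z hz).deriv, hnorm f2 _ z hlap, hn, Real.div_rpow (hEpos _ (hzb z hz)).le hEp.le,
      ← hla, ← mul_div_assoc]
    refine div_le_div_of_nonneg_right ?_ hlap.le
    calc ‖deriv f2 (p + a * z)‖ * a ≤ 2 * m p * E (p + a * z) ^ (α / 2) * a := by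
          gcongr; exact (hsplit z hz).2
      _ = 2 * (m p * a) * E (p + a * z) ^ (α / 2) := by ring
      _ = _ := by rw [hma, mul_one]
  · rw [hn]; simp [hEp.ne']
  · simp [hg1, Complex.div_ofReal_im]
  · simp only [hg2, Complex.div_ofReal_im]; simp
  · rw [(k1 0 z0).deriv, (k2 0 z0).deriv, hnorm f1 _ 0 hlp, hnorm f2 _ 0 hlap]
    have : m p = ‖deriv f1 p‖ / l + ‖deriv f2 p‖ / l ^ α := by rw [hla]
    simp only [mul_zero, add_zero]
    rw [← hma, this]; ring

/-- Ultrafilter version of Montel's theorem for an exhausting sequence of discs. -/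
lemma montel {g : ℕ → ℂ → ℂ} {B : ℝ → ℝ} (hB : Monotone B)
    (hd : ∀ n, DifferentiableOn ℂ (g n) (ball 0 n))
    (hb : ∀ n : ℕ, ∀ z ∈ ball (0:ℂ) n, ‖deriv (g n) z‖ ≤ B ‖z‖) (h0 : ∀ n, ‖g n 0‖ ≤ 1) :
    ∃ G : ℂ → ℂ, Differentiable ℂ G ∧
      (∀ z, Tendsto (fun n => g n z) (hyperfilter ℕ) (𝓝 (G z))) ∧
      Tendsto (fun n => deriv (g n) 0) (hyperfilter ℕ) (𝓝 (deriv G 0)) := by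
  have hge : ∀ r : ℝ, ∀ᶠ n : ℕ in (hyperfilter ℕ : Filter ℕ), r < n := by
    intro r
    exact Filter.Eventually.filter_mono Nat.hyperfilter_le_atTop
      (tendsto_natCast_atTop_atTop.eventually_gt_atTop r)
  have hlip : ∀ r : ℝ, ∀ n : ℕ, r < n → ∀ x ∈ ball (0:ℂ) r, ∀ y ∈ ball (0:ℂ) r,
      ‖g n y - g n x‖ ≤ B r * ‖y - x‖ := by
    intro r n hn x hx y hy
    refine Convex.norm_image_sub_le_of_norm_deriv_le (s := ball 0 r) (fun w hw => ?_)
      (fun w hw => ?_) (convex_ball _ _) hx hy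
    · exact (hd n).differentiableAt (isOpen_ball.mem_nhds (ball_subset_ball hn.le hw))
    · refine (hb n w (ball_subset_ball hn.le hw)).trans (hB ?_)
      exact (mem_ball_zero_iff.1 hw).le
  have hex : ∀ z, ∃ w, Tendsto (fun n => g n z) (hyperfilter ℕ) (𝓝 w) := by
    intro z
    set r := ‖z‖ + 1 with hr
    have hz : z ∈ ball (0:ℂ) r := by rw [mem_ball_zero_iff]; linarith
    have h00 : (0:ℂ) ∈ ball (0:ℂ) r := mem_ball_self (by positivity)
    have hc := isCompact_closedBall (0:ℂ) (1 + B r * ‖z‖)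
    obtain ⟨w, -, hw⟩ := hc.ultrafilter_le_nhds' ((hyperfilter ℕ).map fun n => g n z) (by
      rw [Ultrafilter.mem_map]
      filter_upwards [hge r] with n hn
      have h1 := hlip r n hn 0 h00 z hz
      rw [sub_zero] at h1
      rw [mem_preimage, mem_closedBall_zero_iff]
      have h2 : ‖g n z‖ ≤ ‖g n 0‖ + ‖g n z - g n 0‖ := by
        simpa using norm_add_le (g n 0) (g n z - g n 0)
      linarith [h0 n])
    exact ⟨w, hw⟩
  choose G hG using hex
  have hGlip : ∀ r : ℝ, ∀ x ∈ ball (0:ℂ) r, ∀ y ∈ ball (0:ℂ) r,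
      ‖G y - G x‖ ≤ B r * ‖y - x‖ := by
    intro r x hx y hy
    refine le_of_tendsto ((hG y).sub (hG x)).norm ?_
    filter_upwards [hge r] with n hn
    exact hlip r n hn x hx y hy
  have hunif : ∀ r : ℝ, TendstoLocallyUniformlyOn g G (hyperfilter ℕ) (ball 0 r) := by
    intro r
    rw [Metric.tendstoLocallyUniformlyOn_iff]
    intro ε hε x hx
    set K := |B r| + 1 with hK
    have hKp : 0 < K := by positivity
    have hBK : B r ≤ K := by linarith [le_abs_self (B r)]
    refine ⟨ball 0 r ∩ ball x (ε / (4 * K)), inter_mem self_mem_nhdsWithin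
      (mem_nhdsWithin_of_mem_nhds (ball_mem_nhds _ (by positivity))), ?_⟩
    have h1 := (Metric.tendsto_nhds.1 (hG x)) (ε / 4) (by positivity)
    filter_upwards [hge r, h1] with n hn h1 y hy
    have a1 := hlip r n hn x hx y hy.1
    have a2 := hGlip r x hx y hy.1
    have a3 : ‖y - x‖ ≤ ε / (4 * K) := by rw [← dist_eq_norm]; exact (mem_ball.1 hy.2).le
    have a4 : B r * ‖y - x‖ ≤ ε / 4 := by
      calc B r * ‖y - x‖ ≤ K * (ε / (4 * K)) := by gcongr
        _ = ε / 4 := by field_simp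
    rw [dist_eq_norm] at h1 ⊢
    have a5 : G y - g n y = (G y - G x) - (g n x - G x) - (g n y - g n x) := by ring
    rw [a5]
    have a6 := norm_sub_le ((G y - G x) - (g n x - G x)) (g n y - g n x)
    have a7 := norm_sub_le (G y - G x) (g n x - G x)
    linarith
  have hdiffev : ∀ r : ℝ, ∀ᶠ n : ℕ in (hyperfilter ℕ : Filter ℕ),
      DifferentiableOn ℂ (g n) (ball 0 r) := by
    intro r
    filter_upwards [hge r] with n hn
    exact (hd n).mono (ball_subset_ball hn.le)
  refine ⟨G, fun z => ?_, hG, ?_⟩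
  · have := (hunif (‖z‖ + 1)).differentiableOn (hdiffev _) isOpen_ball
    exact this.differentiableAt (isOpen_ball.mem_nhds (by rw [mem_ball_zero_iff]; linarith))
  · exact ((hunif 1).deriv (hdiffev 1) isOpen_ball).tendsto_at (mem_ball_self one_pos)

lemma core {α s t : ℝ} (hα : 0 < α) (hα1 : α < 1) (hs : s < 0) (ht : 0 < t) (B : ℝ) :
    ∃ M : ℝ, ∀ f1 f2 : ℂ → ℂ, DifferentiableOn ℂ f1 (ball 0 1) →
      DifferentiableOn ℂ f2 (ball 0 1) →
      (∀ z ∈ ball (0:ℂ) 1, phi α s t (f1 z).re < (f2 z).re) →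
      |(f1 0).re| ≤ B → |(f2 0).re| ≤ B → ‖deriv f1 0‖ ≤ M ∧ ‖deriv f2 0‖ ≤ M := by
  by_contra hcon
  push Not at hcon
  -- an upper bound for the size at the centre
  set Q : ℝ := B ^ 2 + |B| ^ (2 / α) + 1 with hQ
  have hQ1 : 1 ≤ Q := by
    have : 0 ≤ |B| ^ (2 / α) := by positivity
    nlinarith [sq_nonneg B]
  have hseq : ∀ n : ℕ, ∃ g1 g2 : ℂ → ℂ,
      DifferentiableOn ℂ g1 (ball 0 n) ∧ DifferentiableOn ℂ g2 (ball 0 n) ∧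
      (∀ z ∈ ball (0:ℂ) n, phi α s t (g1 z).re < (g2 z).re) ∧
      (∀ z ∈ ball (0:ℂ) n, ‖deriv g1 z‖ ≤ 2 * nrg α (g1 z).re (g2 z).re ^ (1 / 2 : ℝ)) ∧
      (∀ z ∈ ball (0:ℂ) n, ‖deriv g2 z‖ ≤ 2 * nrg α (g1 z).re (g2 z).re ^ (α / 2)) ∧
      nrg α (g1 0).re (g2 0).re = 1 ∧ (g1 0).im = 0 ∧ (g2 0).im = 0 ∧
      ‖deriv g1 0‖ + ‖deriv g2 0‖ = 1 := by
    intro n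
    obtain ⟨f1, f2, d1, d2, hA, b1, b2, hM⟩ := hcon (4 * (n + 1) * Q)
    have h00 : (0:ℂ) ∈ ball (0:ℂ) 1 := mem_ball_self one_pos
    have hE0 := nrg_pos hα (hA 0 h00)
    set E := nrg α (f1 0).re (f2 0).re with hE
    have hEQ : E ≤ Q := by
      have e1 : (f1 0).re ^ 2 ≤ B ^ 2 := sq_le_sq' (by linarith [(abs_le.1 b1).1])
        (abs_le.1 b1).2
      have e2 : |(f2 0).re| ^ (2 / α) ≤ |B| ^ (2 / α) :=
        Real.rpow_le_rpow (abs_nonneg _) (b2.trans (le_abs_self B)) (by positivity)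
      rw [hE, nrg, hQ]; linarith
    have hpow : ∀ q : ℝ, 0 < q → q ≤ 1 → E ^ q ≤ Q := by
      intro q hq hq1
      calc E ^ q ≤ Q ^ q := Real.rpow_le_rpow hE0.le hEQ hq.le
        _ ≤ Q ^ (1:ℝ) := Real.rpow_le_rpow_of_exponent_le hQ1 hq1
        _ = Q := Real.rpow_one Q
    have hn : (0:ℝ) ≤ n := Nat.cast_nonneg n
    have n1 : 0 ≤ ‖deriv f1 0‖ / E ^ (1 / 2 : ℝ) := by positivity
    have n2 : 0 ≤ ‖deriv f2 0‖ / E ^ (α / 2) := by positivity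
    have hbig : 4 * ((n:ℝ) + 1) ≤ ‖deriv f1 0‖ / E ^ (1 / 2 : ℝ) + ‖deriv f2 0‖ / E ^ (α / 2) := by
      by_cases hc : ‖deriv f1 0‖ ≤ 4 * (n + 1) * Q
      · have h2 := hM hc
        have : 4 * ((n:ℝ) + 1) ≤ ‖deriv f2 0‖ / E ^ (α / 2) := by
          rw [le_div_iff₀ (by positivity)]
          refine le_trans ?_ h2.le
          gcongr
          exact hpow _ (by positivity) (by linarith)
        linarith
      · push Not at hc
        have : 4 * ((n:ℝ) + 1) ≤ ‖deriv f1 0‖ / E ^ (1 / 2 : ℝ) := by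
          rw [le_div_iff₀ (by positivity)]
          refine le_trans ?_ hc.le
          gcongr
          exact hpow _ (by positivity) (by norm_num)
        linarith
    obtain ⟨g1, g2, e1, e2, e3, e4, e5, e6⟩ := brody hα d1 d2 hA (by positivity) hbig
    have hsub : ball (0:ℂ) n ⊆ ball 0 ((n:ℝ) + 1) := ball_subset_ball (by linarith)
    exact ⟨g1, g2, e1.mono hsub, e2.mono hsub, fun z hz => e3 z (hsub hz),
      fun z hz => e4 z (hsub hz), fun z hz => e5 z (hsub hz), e6⟩
  choose g1 g2 e1 e2 e3 e4 e5 e6 e7 e8 e9 using hseq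
  set C : ℝ := 4 + 4 / α with hC
  have hCp : 0 < C := by positivity
  set Bd : ℝ → ℝ := fun r => 2 * Real.exp (C * max r 0) with hBd
  have hBm : Monotone Bd := by
    intro r r' h
    simp only [hBd]
    gcongr
  have hgr : ∀ n : ℕ, ∀ z ∈ ball (0:ℂ) n, ∀ q : ℝ, 0 < q → q ≤ 1 →
      2 * nrg α (g1 n z).re (g2 n z).re ^ q ≤ Bd ‖z‖ := by
    intro n z hz q hq hq1
    have h1 := growth hα hα1 (e1 n) (e2 n) (e4 n) (e5 n) (e6 n) z hz
    have h2 := Real.rpow_le_rpow (nrg_nonneg _ _ _) h1 hq.le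
    have h3 : Real.exp (C * ‖z‖) ^ q ≤ Real.exp (C * ‖z‖) ^ (1:ℝ) :=
      Real.rpow_le_rpow_of_exponent_le (Real.one_le_exp (by positivity)) hq1
    rw [Real.rpow_one] at h3
    simp only [hBd, max_eq_left (norm_nonneg z)]
    linarith
  have hn0 : ∀ w : ℂ, w.im = 0 → |w.re| ≤ 1 → ‖w‖ ≤ 1 := by
    intro w hw hw1
    have := Complex.norm_le_abs_re_add_abs_im w
    rw [hw, abs_zero] at this
    linarith
  obtain ⟨G1, D1, T1, T1'⟩ := montel hBm e1
    (fun n z hz => (e4 n z hz).trans (hgr n z hz _ (by norm_num) (by norm_num)))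
    (fun n => hn0 _ (e7 n) (by
      have := abs_le_nrg_left α (g1 n 0).re (g2 n 0).re
      rwa [e6, Real.one_rpow] at this))
  obtain ⟨G2, D2, T2, T2'⟩ := montel hBm e2
    (fun n z hz => (e5 n z hz).trans (hgr n z hz _ (by positivity) (by linarith)))
    (fun n => hn0 _ (e8 n) (by
      have := abs_le_nrg_right hα (g1 n 0).re (g2 n 0).re
      rwa [e6, Real.one_rpow] at this))
  have hlim : ∀ z, phi α s t (G1 z).re ≤ (G2 z).re := by
    intro z
    have l1 : Tendsto (fun n => phi α s t (g1 n z).re) (hyperfilter ℕ)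
        (𝓝 (phi α s t (G1 z).re)) :=
      (((phi_continuous hα).comp Complex.continuous_re).tendsto _).comp (T1 z)
    have l2 : Tendsto (fun n => (g2 n z).re) (hyperfilter ℕ) (𝓝 (G2 z).re) :=
      (Complex.continuous_re.tendsto _).comp (T2 z)
    refine le_of_tendsto_of_tendsto l1 l2 ?_
    have : ∀ᶠ n : ℕ in (hyperfilter ℕ : Filter ℕ), ‖z‖ < n :=
      Filter.Eventually.filter_mono Nat.hyperfilter_le_atTop
        (tendsto_natCast_atTop_atTop.eventually_gt_atTop _)
    filter_upwards [this] with n hn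
    exact (e3 n z (by rwa [mem_ball_zero_iff])).le
  obtain ⟨z1, z2⟩ := liouville hα hα1 hs ht D1 D2 hlim 0
  have hsum := T1'.norm.add T2'.norm
  simp only [e9, z1, z2, norm_zero, add_zero] at hsum
  exact one_ne_zero (tendsto_nhds_unique tendsto_const_nhds hsum)

lemma core' {α s t : ℝ} (hα : 0 < α) (hα1 : α ≠ 1) (hs : s < 0) (ht : 0 < t) (B : ℝ) :
    ∃ M : ℝ, ∀ f1 f2 : ℂ → ℂ, DifferentiableOn ℂ f1 (ball 0 1) →
      DifferentiableOn ℂ f2 (ball 0 1) →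
      (∀ z ∈ ball (0:ℂ) 1, phi α s t (f1 z).re < (f2 z).re) →
      |(f1 0).re| ≤ B → |(f2 0).re| ≤ B → ‖deriv f1 0‖ ≤ M ∧ ‖deriv f2 0‖ ≤ M := by
  rcases lt_or_gt_of_ne hα1 with h | h
  · exact core hα h hs ht B
  · have hs' : 0 < -s := by linarith
    obtain ⟨M, hM⟩ := core (α := 1/α) (s := -(1/t)^(1/α)) (t := (1/(-s))^(1/α))
      (by positivity) (by rw [div_lt_one hα]; exact h)
      (neg_lt_zero.2 (by positivity)) (by positivity) B
    refine ⟨M, fun f1 f2 d1 d2 hA b1 b2 => ?_⟩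
    have := hM (-f2) (-f1) d2.neg d1.neg
      (fun z hz => by simpa using phi_swap hα hs ht (hA z hz)) (by simpa using b2)
      (by simpa using b1)
    rw [deriv.neg, deriv.neg, norm_neg, norm_neg] at this
    exact this.symm

end TubeHyp

/-- The tube domain `T_{A_{α,s,t}}` is Kobayashi-hyperbolic: every point has a
neighborhood on which derivatives at `0` of holomorphic maps from the unit disk
are uniformly bounded. -/
theorem tubeA_hyperbolic (α s t : ℝ) (hα : 0 < α) (hα1 : α ≠ 1) (hs : s < 0) (ht : 0 < t)
    (w : ℂ × ℂ) (hw : w ∈ tube (setA α s t)) :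
    ∃ U ⊆ tube (setA α s t), U ∈ 𝓝 w ∧ ∃ M > (0 : ℝ),
      ∀ f : ℂ → ℂ × ℂ, DifferentiableOn ℂ f (ball (0 : ℂ) 1) →
        MapsTo f (ball (0 : ℂ) 1) (tube (setA α s t)) → f 0 ∈ U →
          ‖fderiv ℂ f 0‖ < M := by
  have htube : tube (setA α s t) = {z : ℂ × ℂ | TubeHyp.phi α s t z.1.re < z.2.re} := by
    ext z
    exact TubeHyp.mem_setA_iff hα (z.1.re, z.2.re)
  have hopen : IsOpen (tube (setA α s t)) := by
    rw [htube]
    have h1 : Continuous fun z : ℂ × ℂ => TubeHyp.phi α s t z.1.re :=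
      (TubeHyp.phi_continuous hα).comp (Complex.continuous_re.comp continuous_fst)
    exact isOpen_lt h1 (Complex.continuous_re.comp continuous_snd)
  obtain ⟨M, hM⟩ := TubeHyp.core' hα hα1 hs ht (‖w‖ + 1)
  refine ⟨tube (setA α s t) ∩ ball w 1, inter_subset_left,
    inter_mem (hopen.mem_nhds hw) (ball_mem_nhds w one_pos), |M| + 1, by positivity, ?_⟩
  intro f hf hmaps hf0
  have d1 : DifferentiableOn ℂ (fun z => (f z).1) (ball (0:ℂ) 1) := hf.fst
  have d2 : DifferentiableOn ℂ (fun z => (f z).2) (ball (0:ℂ) 1) := hf.snd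
  have h00 : ball (0:ℂ) 1 ∈ 𝓝 (0:ℂ) := ball_mem_nhds 0 one_pos
  have hn : ‖f 0‖ ≤ ‖w‖ + 1 := by
    have h1 : ‖f 0 - w‖ < 1 := by rw [← dist_eq_norm]; exact hf0.2
    have h2 : ‖f 0‖ ≤ ‖w‖ + ‖f 0 - w‖ := by simpa using norm_add_le w (f 0 - w)
    linarith
  obtain ⟨m1, m2⟩ := hM _ _ d1 d2 (fun z hz => by
      have := hmaps hz
      rw [htube] at this
      exact this)
    ((Complex.abs_re_le_norm _).trans ((norm_fst_le _).trans hn))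
    ((Complex.abs_re_le_norm _).trans ((norm_snd_le _).trans hn))
  have hder : HasDerivAt f (deriv (fun z => (f z).1) 0, deriv (fun z => (f z).2) 0) 0 :=
    HasDerivAt.prodMk (d1.differentiableAt h00).hasDerivAt (d2.differentiableAt h00).hasDerivAt
  rw [← norm_deriv_eq_norm_fderiv, hder.deriv]
  refine lt_of_le_of_lt ?_ (lt_add_one |M|)
  rw [Prod.norm_mk]
  exact max_le (m1.trans (le_abs_self M)) (m2.trans (le_abs_self M))
end

section
/- Let s>0, t>0. Then for every point w in the tube domain T_{B_{s,t}} ⊂ ℂ² there exist a neighborhood U of w in T_{B_{s,t}} and a constant M>0 such that every holomorphic map f: Δ → T_{B_{s,t}} with f(0) ∈ U satisfies ‖f'(0)‖ < M. (This derivative-bound condition characterizes Kobayashi hyperbolicity of T_{B_{s,t}}.) -/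
open Complex Metric Set Filter Topology

/-- The base domain `B_{s,t}`: `x₂ > x₁·log(t·x₁)` for `x₁ > 0`, `x₂ > 0` for `x₁ = 0`,
and `x₂ > x₁·log(s·(-x₁))` for `x₁ < 0`. -/
def setB (s t : ℝ) : Set (ℝ × ℝ) :=
  {x | (0 < x.1 → x.1 * Real.log (t * x.1) < x.2) ∧ (x.1 = 0 → 0 < x.2) ∧
       (x.1 < 0 → x.1 * Real.log (s * (-x.1)) < x.2)}


open InnerProductSpace in
/-- Minimum principle for harmonic functions. -/
lemma minP {T O : Set ℂ} (hT : IsCompact T) (hne : T.Nonempty) (hO : IsOpen O) (hOT : O ⊆ T)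
    {f : ℂ → ℝ} (hf : ContinuousOn f T) (hh : HarmonicOnNhd f O) :
    ∃ z₀ ∈ T \ O, ∀ z ∈ T, f z₀ ≤ f z := by
  obtain ⟨a, haT, ha⟩ := hT.exists_isMinOn hne hf
  have hZ : IsCompact (T ∩ f ⁻¹' Iic (f a)) :=
    hT.of_isClosed_subset (hf.preimage_isClosed_of_isClosed hT.isClosed isClosed_Iic)
      inter_subset_left
  obtain ⟨b, ⟨hbT, hb⟩, hbm⟩ := hZ.exists_isMaxOn ⟨a, haT, le_refl (f a)⟩
    Complex.continuous_re.continuousOn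
  have hbmin : ∀ z ∈ T, f b ≤ f z := fun z hz => le_trans hb (ha hz)
  refine ⟨b, ⟨hbT, fun hbO => ?_⟩, hbmin⟩
  obtain ⟨ε, hε, hball⟩ := Metric.isOpen_iff.1 hO b hbO
  obtain ⟨F, hF, hFf⟩ := HarmonicOnNhd.exists_analyticOnNhd_ball_re_eq (hh.mono hball)
  have hbb : b ∈ ball b ε := mem_ball_self hε
  have hev := Complex.eventually_eq_of_isLocalMax_norm (f := fun z => Complex.exp (-F z)) (c := b)
    (by
      filter_upwards [ball_mem_nhds b hε] with z hz
      exact ((hF z hz).differentiableAt.neg).cexp)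
    (by
      filter_upwards [ball_mem_nhds b hε] with z hz
      simp only [Function.comp, Complex.norm_exp, Complex.neg_re]
      have h1 := hFf hz
      have h2 := hFf hbb
      simp only at h1 h2
      rw [h1, h2]
      exact Real.exp_le_exp.2 (neg_le_neg (hbmin z (hOT (hball hz)))))
  obtain ⟨r, hr, hr2⟩ := Metric.eventually_nhds_iff_ball.1 (hev.and (ball_mem_nhds b hε))
  have hq : b + ((r / 2 : ℝ) : ℂ) ∈ ball b r := by
    simp only [mem_ball, dist_self_add_left, Complex.norm_real, Real.norm_eq_abs]
    rw [abs_of_pos (by positivity)]; linarith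
  obtain ⟨h3, h4⟩ := hr2 _ hq
  have h5 : f (b + ((r / 2 : ℝ) : ℂ)) = f b := by
    have h1 := hFf h4
    have h2 := hFf hbb
    simp only at h1 h2
    have := congrArg norm h3
    simp only [Complex.norm_exp, Complex.neg_re, h1, h2] at this
    have := Real.exp_injective this
    linarith
  have h6 := hbm (a := b + ((r / 2 : ℝ) : ℂ)) ⟨hOT (hball h4), by
    show f _ ≤ f a
    rw [h5]; exact hb⟩
  simp at h6
  linarith

lemma kern {z w : ℂ} {a b : ℝ} (hz : ‖z‖ = Real.exp (-b)) (hw : ‖w‖ = Real.exp (-a))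
    (hab : a ≠ b) : -Real.log ‖z - w‖ ≤ min a b + 2 / √|a - b| := by
  have hy : 0 < |a - b| := abs_pos.2 (sub_ne_zero.2 hab)
  set y := |a - b| with hyd
  have h1 : Real.exp (-min a b) * (1 - Real.exp (-y)) ≤ ‖z - w‖ := by
    have h2 := abs_norm_sub_norm_le z w
    refine le_trans (le_of_eq ?_) h2
    rw [hz, hw]
    rcases lt_or_gt_of_ne hab with h | h
    · rw [min_eq_left h.le, hyd, abs_of_neg (by linarith : a - b < 0), mul_sub, ← Real.exp_add,
        abs_of_neg (by rw [sub_neg]; exact Real.exp_lt_exp.2 (by linarith))]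
      ring_nf
    · rw [min_eq_right h.le, hyd, abs_of_pos (by linarith : 0 < a - b), mul_sub, ← Real.exp_add,
        abs_of_pos (by rw [sub_pos]; exact Real.exp_lt_exp.2 (by linarith))]
      ring_nf
  have h3 : y / (1 + y) ≤ 1 - Real.exp (-y) := by
    have := Real.add_one_le_exp y
    rw [Real.exp_neg, div_le_iff₀ (by positivity)]
    have h4 : (Real.exp y)⁻¹ * (1 + y) ≤ 1 := by
      rw [inv_mul_le_iff₀ (Real.exp_pos y)]; linarith
    nlinarith
  have hs : 0 < √y := Real.sqrt_pos.2 hy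
  have h4 : (1 + 1 / √y)⁻¹ ^ 2 ≤ y / (1 + y) := by
    have hsq : √y ^ 2 = y := Real.sq_sqrt hy.le
    rw [inv_pow, inv_le_comm₀ (by positivity) (by positivity), inv_div]
    rw [div_le_iff₀ hy]
    nth_rewrite 1 3 [← hsq]
    have : (1 + 1 / √y) ^ 2 * √y ^ 2 = (√y + 1) ^ 2 := by field_simp
    rw [this]; nlinarith
  have h5 : Real.exp (-min a b) * (1 + 1 / √y)⁻¹ ^ 2 ≤ ‖z - w‖ :=
    le_trans (mul_le_mul_of_nonneg_left (h4.trans h3) (Real.exp_pos _).le) h1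
  have h6 := Real.log_le_log (by positivity) h5
  rw [Real.log_mul (by positivity) (by positivity), Real.log_exp, Real.log_pow, Real.log_inv] at h6
  have h7 := Real.log_le_sub_one_of_pos (show 0 < 1 + 1 / √y by positivity)
  have h8 : 2 / √y = 2 * (1 / √y) := by ring
  push_cast at h6
  rw [h8]; linarith

lemma sum_inv_sqrt (M : ℕ) {δ : ℝ} (hδ : 0 < δ) :
    ∑ k ∈ Finset.range M, δ * (2 / √(k * δ)) ≤ 6 * √(M * δ) := by
  induction M with
  | zero => simp
  | succ n ih =>
    rw [Finset.sum_range_succ]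
    refine le_trans (add_le_add_left ih _) ?_
    rcases Nat.eq_zero_or_pos n with rfl | hn
    · simp
    have hn' : (0 : ℝ) < n := by exact_mod_cast hn
    have hx : 0 < √(n * δ) := Real.sqrt_pos.2 (by positivity)
    have hx2 : √(n * δ) ^ 2 = n * δ := Real.sq_sqrt (by positivity)
    have hy2 : √((n + 1 : ℕ) * δ) ^ 2 = n * δ + δ := by
      rw [Real.sq_sqrt (by positivity)]; push_cast; ring
    have hy : 0 ≤ √((n + 1 : ℕ) * δ) := Real.sqrt_nonneg _
    have hn1 : (1 : ℝ) ≤ n := by exact_mod_cast hn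
    have hle : √((n + 1 : ℕ) * δ) ≤ 2 * √(n * δ) := by
      nlinarith [mul_le_mul_of_nonneg_right hn1 hδ.le]
    have hge : √(n * δ) ≤ √((n + 1 : ℕ) * δ) := by
      apply Real.sqrt_le_sqrt; push_cast; nlinarith
    generalize √(n * δ) = x at *
    generalize √((n + 1 : ℕ) * δ) = y at *
    have e : δ = (y - x) * (y + x) := by nlinarith
    have : δ * (2 / x) ≤ 6 * (y - x) := by
      rw [mul_div_assoc', div_le_iff₀ hx, e]
      nlinarith [mul_nonneg (sub_nonneg.2 hge) (sub_nonneg.2 hle)]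
    linarith

lemma sum_F (M N : ℕ) (h : M ≤ N) {δ L : ℝ} (hδ : 0 < δ) (hL : 0 ≤ L) :
    ∑ k ∈ Finset.range M, δ * (2 / √(k * δ) + if k = 0 then L else 0) ≤ 6 * √(N * δ) + δ * L := by
  simp_rw [mul_add]
  rw [Finset.sum_add_distrib]
  refine add_le_add ((sum_inv_sqrt M hδ).trans ?_) ?_
  · gcongr
  · simp only [mul_ite, mul_zero, Finset.sum_ite_eq', Finset.mem_range]
    split_ifs
    · exact le_rfl
    · positivity

lemma sum_bound {δ L b : ℝ} (hδ : 0 < δ) (hL : 0 ≤ L) (hb : 0 ≤ b) (N : ℕ) (k : ℕ → ℝ)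
    (h1 : ∀ j ≤ N, k j ≤ L)
    (h2 : ∀ j ≤ N, (j * δ : ℝ) ≠ b → k j ≤ min (j * δ) b + 2 / √|j * δ - b|) :
    ∑ j ∈ Finset.range (N + 1), δ * k j ≤
      ∑ j ∈ Finset.range (N + 1), δ * min (j * δ) b + (12 * √((N + 1 : ℕ) * δ) + 2 * δ * L) := by
  set F : ℕ → ℝ := fun k => δ * (2 / √(k * δ) + if k = 0 then L else 0) with hF
  set n := min ⌊b / δ⌋₊ N with hn
  have hfl : (⌊b / δ⌋₊ : ℝ) * δ ≤ b := by
    rw [← le_div_iff₀ hδ]; exact Nat.floor_le (by positivity)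
  have hfl2 : b < (⌊b / δ⌋₊ + 1 : ℝ) * δ := by
    rw [← div_lt_iff₀ hδ]; exact Nat.lt_floor_add_one _
  have key : ∀ (j i : ℕ), j ≤ N → (i * δ ≤ |j * δ - b|) →
      δ * k j ≤ δ * min (j * δ) b + F i := by
    intro j i hj hi
    simp only [hF]
    rw [← mul_add]
    refine mul_le_mul_of_nonneg_left ?_ hδ.le
    have hmin : 0 ≤ min (j * δ) b := le_min (by positivity) hb
    rcases Nat.eq_zero_or_pos i with rfl | hi0
    · simp only [if_true]
      have := h1 j hj
      have : (0:ℝ) ≤ 2 / √((0:ℕ) * δ) := by positivity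
      linarith [h1 j hj]
    · have hi' : (0 : ℝ) < i * δ := by have : (0:ℝ) < i := by exact_mod_cast hi0
                                       positivity
      rw [if_neg hi0.ne', add_zero]
      have hne : (j * δ : ℝ) ≠ b := by
        intro h; rw [h] at hi; simp at hi; linarith
      refine (h2 j hj hne).trans (add_le_add_right ?_ _)
      have : 0 < √(i * δ) := Real.sqrt_pos.2 hi'
      gcongr
  have hnN : n ≤ N := min_le_right _ _
  have split : ∀ g : ℕ → ℝ, ∑ j ∈ Finset.range (N + 1), g j =
      ∑ j ∈ Finset.range (n + 1), g j + ∑ i ∈ Finset.range (N - n), g (n + 1 + i) := by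
    intro g
    rw [← Finset.sum_range_add]
    congr 2; omega
  rw [split, split]
  have hA : ∑ j ∈ Finset.range (n + 1), δ * k j ≤
      ∑ j ∈ Finset.range (n + 1), δ * min (j * δ) b + (6 * √((N + 1 : ℕ) * δ) + δ * L) := by
    refine le_trans ?_ (add_le_add_right (sum_F (n + 1) (N + 1) (by omega) hδ hL) _)
    rw [← Finset.sum_range_reflect F, ← Finset.sum_add_distrib]
    refine Finset.sum_le_sum fun j hj => ?_
    have hj' : j ≤ n := by have := Finset.mem_range.1 hj; omega
    refine key j (n + 1 - 1 - j) (hj'.trans hnN) ?_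
    have e : ((n + 1 - 1 - j : ℕ) : ℝ) = n - j := by
      rw [Nat.add_sub_cancel, Nat.cast_sub hj']
    rw [e]
    have : (n : ℝ) ≤ ⌊b / δ⌋₊ := by exact_mod_cast min_le_left _ _
    have := mul_le_mul_of_nonneg_right this hδ.le
    refine le_trans ?_ (neg_le_abs _)
    linarith
  have hB : ∑ i ∈ Finset.range (N - n), δ * k (n + 1 + i) ≤
      ∑ i ∈ Finset.range (N - n), δ * min ((n + 1 + i : ℕ) * δ) b
        + (6 * √((N + 1 : ℕ) * δ) + δ * L) := by
    refine le_trans ?_ (add_le_add_right (sum_F (N - n) (N + 1) (by omega) hδ hL) _)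
    rw [← Finset.sum_add_distrib]
    refine Finset.sum_le_sum fun i hi => ?_
    have hi' := Finset.mem_range.1 hi
    refine key (n + 1 + i) i (by omega) ?_
    have : n = ⌊b / δ⌋₊ := by omega
    rw [← this] at hfl2
    refine le_trans ?_ (le_abs_self _)
    push_cast
    linarith
  linarith

open InnerProductSpace in
lemma circle_pts {u : ℂ → ℝ} (hu : HarmonicOnNhd u (ball 0 2)) {c ρ : ℝ} (hρ : ρ ≤ 1)
    {z : ℂ} (hz : ‖z‖ ≤ ρ) (h : u z ≤ c) : ∃ w : ℂ, ‖w‖ = ρ ∧ u w ≤ c := by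
  have hsub : closedBall (0 : ℂ) ρ ⊆ ball 0 2 := closedBall_subset_ball (by linarith)
  obtain ⟨w, ⟨hw1, hw2⟩, hw⟩ := minP (isCompact_closedBall (0 : ℂ) ρ) ⟨z, by simpa using hz⟩
    isOpen_ball ball_subset_closedBall (hu.continuousOn.mono hsub)
    (hu.mono (ball_subset_closedBall.trans hsub))
  refine ⟨w, ?_, (hw z (by simpa using hz)).trans h⟩
  simp at hw1 hw2
  linarith

open InnerProductSpace in
lemma core {P : ℝ} (hP : 0 < P) : ∃ A > (0 : ℝ), ∀ (u H : ℂ → ℝ) (m K : ℝ),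
    HarmonicOnNhd u (ball 0 2) → HarmonicOnNhd H (ball 0 2) → -m < u 0 → u 0 < K →
    (∀ z : ℂ, ‖z‖ ≤ 1 → (u z = -m ∨ u z = K) → 0 ≤ H z) →
    (∀ z : ℂ, ‖z‖ = 1 → -m ≤ u z → u z ≤ K → -P ≤ H z) →
    (∃ z : ℂ, ‖z‖ ≤ Real.exp (-A) ∧ (u z ≤ -m - 1 ∨ K + 1 ≤ u z)) → -1 ≤ H 0 := by
  refine ⟨50 * P + 1, by positivity, ?_⟩
  set A := 50 * P + 1 with hAd
  intro u H m K hu hH hm0 hK0 hin hout hex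
  have hA : 0 < A := by positivity
  have hsub : closedBall (0 : ℂ) 1 ⊆ ball 0 2 := closedBall_subset_ball (by norm_num)
  -- points on every circle
  have hpts : ∀ ρ : ℝ, Real.exp (-A) ≤ ρ → ρ ≤ 1 →
      ∃ w : ℂ, ‖w‖ = ρ ∧ (u w ≤ -m - 1 ∨ K + 1 ≤ u w) := by
    intro ρ h1 h2
    obtain ⟨z, hz, hz' | hz'⟩ := hex
    · obtain ⟨w, hw, hw'⟩ := circle_pts hu h2 (hz.trans h1) hz'
      exact ⟨w, hw, Or.inl hw'⟩
    · obtain ⟨w, hw, hw'⟩ := circle_pts hu.neg (c := -(K + 1)) h2 (hz.trans h1)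
        (by simpa using neg_le_neg hz')
      exact ⟨w, hw, Or.inr (by simp only [Pi.neg_apply] at hw'; linarith)⟩
  -- separation
  have hucl : ContinuousOn u (closedBall 0 1) := hu.continuousOn.mono hsub
  have huc := (isCompact_closedBall (0 : ℂ) 1).uniformContinuousOn_of_continuous hucl
  obtain ⟨η₀, hη₀, hsep₀⟩ := Metric.uniformContinuousOn_iff.1 huc 1 one_pos
  set η := min η₀ 1 with hηd
  have hη : 0 < η := lt_min hη₀ one_pos
  have hη1 : η ≤ 1 := min_le_right _ _
  set T : Set ℂ := closedBall 0 1 ∩ u ⁻¹' Icc (-m) K with hTd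
  have hsep : ∀ z ∈ T, ∀ w : ℂ, ‖w‖ ≤ 1 → (u w ≤ -m - 1 ∨ K + 1 ≤ u w) → η ≤ ‖z - w‖ := by
    intro z hz w hw hw'
    by_contra hlt
    push Not at hlt
    have := hsep₀ z hz.1 w (by simpa using hw)
      (by rw [dist_eq_norm]; exact hlt.trans_le (min_le_left _ _))
    rw [Real.dist_eq, abs_lt] at this
    have h1 := hz.2.1
    have h2 := hz.2.2
    rcases hw' with h | h <;> linarith [this.1, this.2]
  set L := -Real.log η with hLd
  have hL : 0 ≤ L := by
    have := Real.log_nonpos hη.le hη1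
    linarith
  obtain ⟨N, hN⟩ := exists_nat_gt (A * (1 + 2 * L))
  have hN0 : (0 : ℝ) < N := lt_of_le_of_lt (by positivity) hN
  set δ := A / N with hδd
  have hδ : 0 < δ := by positivity
  have hNδ : N * δ = A := by rw [hδd]; field_simp
  have hδ1 : δ * (1 + 2 * L) ≤ 1 := by
    rw [hδd, div_mul_eq_mul_div, div_le_one hN0]; exact hN.le
  have hchoice : ∀ j : ℕ, ∃ w : ℂ, j ≤ N → ‖w‖ = Real.exp (-(j * δ)) ∧
      (u w ≤ -m - 1 ∨ K + 1 ≤ u w) := by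
    intro j
    by_cases hj : j ≤ N
    · have hj' : (j : ℝ) ≤ N := by exact_mod_cast hj
      obtain ⟨w, hw⟩ := hpts (Real.exp (-(j * δ)))
        (Real.exp_le_exp.2 (by rw [← hNδ]; nlinarith))
        (Real.exp_le_one_iff.2 (by have : 0 ≤ j * δ := by positivity
                                   linarith))
      exact ⟨w, fun _ => hw⟩
    · exact ⟨0, fun h => absurd h hj⟩
  choose pt hpt using hchoice
  have hpt1 : ∀ j ≤ N, ‖pt j‖ ≤ 1 := fun j hj => by
    rw [(hpt j hj).1]
    exact Real.exp_le_one_iff.2 (by have : 0 ≤ j * δ := by positivity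
                                    linarith)
  set W : ℂ → ℂ := fun z => ∏ j ∈ Finset.range (N + 1), (z - pt j) with hWd
  have hne : ∀ z ∈ T, ∀ j ∈ Finset.range (N + 1), z - pt j ≠ 0 := by
    intro z hz j hj
    have hj' : j ≤ N := by have := Finset.mem_range.1 hj; omega
    have := hsep z hz (pt j) (hpt1 j hj') (hpt j hj').2
    exact norm_pos_iff.1 (lt_of_lt_of_le hη this)
  have hWlog : ∀ z ∈ T, δ * Real.log ‖W z‖ =
      -∑ j ∈ Finset.range (N + 1), δ * (-Real.log ‖z - pt j‖) := by
    intro z hz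
    rw [hWd, norm_prod, Real.log_prod (fun j hj => norm_ne_zero_iff.2 (hne z hz j hj)),
      Finset.mul_sum, ← Finset.sum_neg_distrib]
    refine Finset.sum_congr rfl fun j _ => by ring
  set S := ∑ j ∈ Finset.range (N + 1), δ * (j * δ) with hSd
  set X := 12 * √((N + 1 : ℕ) * δ) + 2 * δ * L with hXd
  have hX0 : 0 ≤ X := by positivity
  have hXle : X ≤ 12 * A + 13 := by
    have h1 : δ ≤ 1 := by nlinarith [mul_nonneg hδ.le hL]
    have h2 : √((N + 1 : ℕ) * δ) ≤ A + 1 := by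
      rw [Real.sqrt_le_left (by positivity)]
      push_cast
      nlinarith
    have : 2 * δ * L ≤ 1 := by nlinarith
    linarith
  have hSge : A ^ 2 / 2 ≤ S := by
    have h1 : S = δ ^ 2 * ∑ j ∈ Finset.range (N + 1), (j : ℝ) := by
      rw [hSd, Finset.mul_sum]; refine Finset.sum_congr rfl fun j _ => by ring
    have h2 : (∑ j ∈ Finset.range (N + 1), (j : ℝ)) * 2 = (N + 1) * N := by
      have := Finset.sum_range_id_mul_two (N + 1)
      have h3 : ((∑ j ∈ Finset.range (N + 1), j : ℕ) : ℝ) * 2 = ((N + 1) * N : ℕ) := by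
        rw [Nat.add_sub_cancel] at this; exact_mod_cast this
      push_cast at h3
      exact h3
    rw [h1, ← hNδ]
    nlinarith [sq_nonneg δ, mul_nonneg (sq_nonneg δ) hN0.le]
  have hS : 0 < S := lt_of_lt_of_le (by positivity) hSge
  have hPX : P * X ≤ S := by
    have : P * X ≤ P * (12 * A + 13) := mul_le_mul_of_nonneg_left hXle hP.le
    refine this.trans (le_trans ?_ hSge)
    rw [hAd]; nlinarith
  -- bound of the potential
  have hpot : ∀ z ∈ T, z ≠ 0 → ∃ b : ℝ, ‖z‖ = Real.exp (-b) ∧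
      -(δ * Real.log ‖W z‖) ≤ ∑ j ∈ Finset.range (N + 1), δ * min (j * δ) b + X := by
    intro z hz hz0
    have hzn : 0 < ‖z‖ := norm_pos_iff.2 hz0
    have hz1 : ‖z‖ ≤ 1 := by simpa using hz.1
    have hb : ‖z‖ = Real.exp (-(-Real.log ‖z‖)) := by rw [neg_neg, Real.exp_log hzn]
    refine ⟨-Real.log ‖z‖, hb, ?_⟩
    rw [hWlog z hz, neg_neg]
    refine sum_bound hδ hL (by have := Real.log_nonpos hzn.le hz1
                               linarith) N (fun j => -Real.log ‖z - pt j‖) ?_ ?_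
    · intro j hj
      exact neg_le_neg (Real.log_le_log hη (hsep z hz _ (hpt1 j hj) (hpt j hj).2))
    · intro j hj hne
      exact kern hb (hpt j hj).1 hne
  have h0T : (0 : ℂ) ∈ T := ⟨by simp, hm0.le, hK0.le⟩
  have hW0 : δ * Real.log ‖W 0‖ = -S := by
    rw [hWlog 0 h0T, hSd]
    congr 1
    refine Finset.sum_congr rfl fun j hj => ?_
    have hj' : j ≤ N := by have := Finset.mem_range.1 hj; omega
    rw [zero_sub, norm_neg, (hpt j hj').1, Real.log_exp, neg_neg]
  -- the comparison function
  set Q : ℂ → ℝ := H + ((P / S) • ((fun _ => S + X) + δ • (fun z => Real.log ‖W z‖))) with hQd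
  have hQ : ∀ z, Q z = H z + P / S * (S + X + δ * Real.log ‖W z‖) := fun z => rfl
  have hQh : HarmonicOnNhd Q T := by
    intro z hz
    have hWz : HarmonicAt (fun z => Real.log ‖W z‖) z := by
      apply AnalyticAt.harmonicAt_log_norm
      · rw [hWd]; fun_prop
      · exact Finset.prod_ne_zero_iff.2 (hne z hz)
    exact (hH z (hsub hz.1)).add (HarmonicAt.const_smul
      ((harmonicAt_const _).add (HarmonicAt.const_smul hWz)))
  set O : Set ℂ := ball 0 1 ∩ u ⁻¹' Ioo (-m) K with hOd
  have hOT : O ⊆ T := fun z hz => ⟨ball_subset_closedBall hz.1, hz.2.1.le, hz.2.2.le⟩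
  have hOo : IsOpen O :=
    (hucl.mono ball_subset_closedBall).isOpen_inter_preimage isOpen_ball isOpen_Ioo
  have hTc : IsCompact T := (isCompact_closedBall (0 : ℂ) 1).of_isClosed_subset
    (hucl.preimage_isClosed_of_isClosed isClosed_closedBall isClosed_Icc) inter_subset_left
  obtain ⟨z, ⟨hzT, hzO⟩, hzmin⟩ := minP hTc ⟨0, h0T⟩ hOo hOT hQh.continuousOn (hQh.mono hOT)
  have hz0 : z ≠ 0 := by
    rintro rfl
    exact hzO ⟨by simp, hm0, hK0⟩
  have hz1 : ‖z‖ ≤ 1 := by simpa using hzT.1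
  obtain ⟨b, hb, hbd⟩ := hpot z hzT hz0
  have hPS : 0 < P / S := by positivity
  have hQz : 0 ≤ Q z := by
    rw [hQ]
    by_cases hnorm : ‖z‖ = 1
    · have hb0 : b = 0 := by
        rw [hnorm] at hb
        have := congrArg Real.log hb
        rw [Real.log_one, Real.log_exp] at this
        linarith
      have h1 : ∑ j ∈ Finset.range (N + 1), δ * min (j * δ) b = 0 := by
        refine Finset.sum_eq_zero fun j _ => ?_
        rw [hb0, min_eq_right (by positivity), mul_zero]
      rw [h1] at hbd
      have h2 := hout z hnorm hzT.2.1 hzT.2.2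
      have h3 : P / S * S ≤ P / S * (S + X + δ * Real.log ‖W z‖) :=
        mul_le_mul_of_nonneg_left (by linarith) hPS.le
      rw [div_mul_cancel₀ _ hS.ne'] at h3
      linarith
    · have hlt : ‖z‖ < 1 := lt_of_le_of_ne hz1 hnorm
      have h1 : u z = -m ∨ u z = K := by
        by_contra hcon
        push Not at hcon
        exact hzO ⟨by simpa using hlt, lt_of_le_of_ne hzT.2.1 (Ne.symm hcon.1),
          lt_of_le_of_ne hzT.2.2 hcon.2⟩
      have h2 := hin z hz1 h1
      have h3 : ∑ j ∈ Finset.range (N + 1), δ * min (j * δ) b ≤ S :=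
        Finset.sum_le_sum fun j _ => mul_le_mul_of_nonneg_left (min_le_left _ _) hδ.le
      have h4 : 0 ≤ P / S * (S + X + δ * Real.log ‖W z‖) :=
        mul_nonneg hPS.le (by linarith)
      linarith
  have hfin := hQz.trans (hzmin 0 h0T)
  rw [hQ, hW0] at hfin
  have : P / S * (S + X + -S) ≤ 1 := by
    rw [add_comm S X, add_neg_cancel_right, div_mul_eq_mul_div, div_le_one hS]
    exact hPX
  linarith

lemma deriv_bound {F : ℂ → ℂ} {R C : ℝ} (hR : 0 < R) (hC : 0 < C)
    (hF : DifferentiableOn ℂ F (ball 0 R)) (h1 : ∀ z ∈ ball (0 : ℂ) R, -C ≤ (F z).re)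
    (h0 : (F 0).re ≤ C) : ‖deriv F 0‖ ≤ 8 * C / R := by
  have hG : DifferentiableOn ℂ (fun z => F 0 - F z) (ball 0 R) := by fun_prop
  have hb : ∀ z ∈ sphere (0 : ℂ) (R / 2), ‖F 0 - F z‖ ≤ 4 * C := by
    intro z hz
    have hz' : ‖z‖ = R / 2 := by simpa using hz
    have := Complex.borelCaratheodory_zero (M := 2 * C) (z := z) (by positivity) hG
      (fun w hw => by
        have := h1 w hw
        simp only [Set.mem_ofPred_eq, Complex.sub_re]; linarith) hR
      (by simp [hz']; linarith) (by simp)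
    refine this.trans (le_of_eq ?_)
    rw [hz']; field_simp; ring
  have := Complex.norm_deriv_le_of_forall_mem_sphere_norm_le (half_pos hR)
    (f := fun z => F 0 - F z)
    (hG.mono (by rw [closure_ball _ (half_pos hR).ne']
                 exact closedBall_subset_ball (by linarith))).diffContOnCl hb
  rw [deriv_const_sub, norm_neg] at this
  refine this.trans (le_of_eq ?_)
  field_simp; ring

/-- The boundary function of `setB s t`. -/
noncomputable def phiB (s t x : ℝ) : ℝ :=
  x * Real.log x + max x 0 * Real.log t + min x 0 * Real.log s

lemma continuous_phiB (s t : ℝ) : Continuous (phiB s t) := by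
  unfold phiB
  have := Real.continuous_mul_log
  fun_prop

lemma mem_setB_iff {s t : ℝ} (hs : 0 < s) (ht : 0 < t) (x : ℝ × ℝ) :
    x ∈ setB s t ↔ phiB s t x.1 < x.2 := by
  obtain ⟨x, y⟩ := x
  simp only [setB, phiB, Set.mem_ofPred_eq]
  rcases lt_trichotomy x 0 with h | rfl | h
  · have e : Real.log (s * -x) = Real.log s + Real.log x := by
      rw [Real.log_mul hs.ne' (by linarith), Real.log_neg_eq_log]
    rw [e, max_eq_right h.le, min_eq_left h.le]
    have e2 : x * (Real.log s + Real.log x) =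
      x * Real.log x + 0 * Real.log t + x * Real.log s := by ring
    rw [e2]
    simp [h, h.ne, h.le]
  · simp
  · have e : Real.log (t * x) = Real.log t + Real.log x := by
      rw [Real.log_mul ht.ne' h.ne']
    rw [e, max_eq_left h.le, min_eq_right h.le]
    have e2 : x * (Real.log t + Real.log x) =
      x * Real.log x + x * Real.log t + 0 * Real.log s := by ring
    rw [e2]
    simp [h, h.ne', h.le]

/-- The tube domain `T_{B_{s,t}}` is Kobayashi-hyperbolic: every point has a
neighborhood on which derivatives at `0` of holomorphic maps from the unit disk
are uniformly bounded. -/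
theorem tubeB_hyperbolic (s t : ℝ) (hs : 0 < s) (ht : 0 < t)
    (w : ℂ × ℂ) (hw : w ∈ tube (setB s t)) :
    ∃ U ⊆ tube (setB s t), U ∈ 𝓝 w ∧ ∃ M > (0 : ℝ),
      ∀ f : ℂ → ℂ × ℂ, DifferentiableOn ℂ f (ball (0 : ℂ) 1) →
        MapsTo f (ball (0 : ℂ) 1) (tube (setB s t)) → f 0 ∈ U →
          ‖fderiv ℂ f 0‖ < M := by
  have htube : ∀ z : ℂ × ℂ, z ∈ tube (setB s t) ↔ phiB s t z.1.re < z.2.re :=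
    fun z => mem_setB_iff hs ht (z.1.re, z.2.re)
  have hφ := continuous_phiB s t
  set φ := phiB s t with hφd
  set x := w.1.re with hx
  set y := w.2.re with hy
  set m := |x| + 2 with hm
  set a := |y + 1 - φ (-m)| + 2 with ha
  have ha0 : 0 < a := by positivity
  set q := a + |Real.log t| + |a * m + φ (-m)| + |x| + 2 with hq
  set K := Real.exp q with hK
  have hq0 : 0 ≤ q := by positivity
  have hKq : q + 1 ≤ K := Real.add_one_le_exp q
  have hKx : |x| + 1 < K := by
    have : |x| + 2 ≤ q := by
      have := abs_nonneg (Real.log t)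
      have := abs_nonneg (a * m + φ (-m))
      linarith
    linarith
  have hφK : a * (K + m) + φ (-m) ≤ φ K := by
    have e : φ K = K * (q + Real.log t) := by
      have hKp : 0 < K := Real.exp_pos q
      rw [hφd, phiB, max_eq_left hKp.le, min_eq_right hKp.le, hK, Real.log_exp]; ring
    rw [e]
    have h1 : |a * m + φ (-m)| ≤ q + Real.log t - a := by
      have := neg_abs_le (Real.log t)
      have := abs_nonneg x
      linarith
    have h2 := le_abs_self (a * m + φ (-m))
    have h3 := abs_nonneg (a * m + φ (-m))
    nlinarith
  obtain ⟨P₀, hP₀⟩ := (isCompact_Icc (a := -m) (b := K)).exists_bound_of_continuousOn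
    (f := fun x => a * (x + m) + φ (-m) - φ x) (by fun_prop)
  obtain ⟨A, hA, hcore⟩ := core (P := |P₀| + 1) (by positivity)
  obtain ⟨C₀, hC₀⟩ := (isCompact_Icc (a := -m - 1) (b := K + 1)).exists_bound_of_continuousOn
    (f := φ) hφ.continuousOn
  set d := Real.exp (-A) with hd
  have hd0 : 0 < d := Real.exp_pos _
  have hd1 : d ≤ 1 := Real.exp_le_one_iff.2 (by linarith)
  set C := |C₀| + |y| + |x| + m + K + 5 with hC
  have hm0 : 0 < m := by positivity
  have hKp : 0 < K := Real.exp_pos q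
  have hCp : 0 < C := by positivity
  refine ⟨tube (setB s t) ∩ {z | |z.1.re - x| < 1 ∧ z.2.re < y + 1}, inter_subset_left, ?_,
    8 * C / (d / 2) + 1, by positivity, ?_⟩
  · refine IsOpen.mem_nhds ?_ ⟨hw, by simp [hx], by simp [hy]⟩
    have e : tube (setB s t) = {z : ℂ × ℂ | φ z.1.re < z.2.re} := Set.ext htube
    rw [e]
    refine (isOpen_lt (by fun_prop) (by fun_prop)).inter ?_
    have o1 : IsOpen {z : ℂ × ℂ | |z.1.re - x| < 1} := isOpen_lt (by fun_prop) (by fun_prop)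
    have o2 : IsOpen {z : ℂ × ℂ | z.2.re < y + 1} := isOpen_lt (by fun_prop) (by fun_prop)
    exact o1.inter o2
  intro f hf hmaps hf0
  obtain ⟨-, hu0, hv0⟩ := hf0
  rw [abs_lt] at hu0
  have hxa := neg_abs_le x
  have hxb := le_abs_self x
  have hg : DifferentiableOn ℂ (fun z => (f z).1) (ball 0 1) := hf.fst
  have hh : DifferentiableOn ℂ (fun z => (f z).2) (ball 0 1) := hf.snd
  have hmap2 : MapsTo (fun z : ℂ => z / 2) (ball 0 2) (ball 0 1) := by
    intro z hz
    have : ‖z‖ < 2 := by simpa using hz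
    simp only [mem_ball, dist_zero_right, norm_div, Complex.norm_ofNat]
    linarith
  have hin : ∀ z ∈ ball (0 : ℂ) 2, φ (f (z / 2)).1.re < (f (z / 2)).2.re := fun z hz =>
    (htube _).1 (hmaps (hmap2 hz))
  have hg2 : DifferentiableOn ℂ (fun z => (f (z / 2)).1) (ball 0 2) :=
    hg.comp (by fun_prop) hmap2
  have hh2 : DifferentiableOn ℂ (fun z => (f (z / 2)).2) (ball 0 2) :=
    hh.comp (by fun_prop) hmap2
  set u : ℂ → ℝ := fun z => (f (z / 2)).1.re with hu
  set H : ℂ → ℝ := fun z =>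
    ((f (z / 2)).2 - (a : ℂ) * ((f (z / 2)).1 + (m : ℂ)) - ((φ (-m) : ℝ) : ℂ)).re with hH
  have hHe : ∀ z, H z = (f (z / 2)).2.re - a * (u z + m) - φ (-m) := by
    intro z
    simp [hH, hu]
  have hball1 : ∀ z : ℂ, ‖z‖ ≤ 1 → z ∈ ball (0 : ℂ) 2 := fun z hz => by
    simp only [mem_ball, dist_zero_right]; linarith
  have hsmall : ∀ z : ℂ, ‖z‖ ≤ d → -m - 1 < u z ∧ u z < K + 1 := by
    by_contra hcon
    push Not at hcon
    obtain ⟨z, hz, hz'⟩ := hcon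
    have := hcore u H m K
      (fun z hz => (hg2.analyticAt (isOpen_ball.mem_nhds hz)).harmonicAt_re)
      (fun z hz => by
        apply AnalyticAt.harmonicAt_re
        have h1 := hg2.analyticAt (isOpen_ball.mem_nhds hz)
        have h2 := hh2.analyticAt (isOpen_ball.mem_nhds hz)
        exact (h2.sub (analyticAt_const.mul (h1.add analyticAt_const))).sub analyticAt_const)
      (by simp only [hu, zero_div]; linarith)
      (by simp only [hu, zero_div]; linarith)
      (by
        intro z hz h
        have h1 := hin z (hball1 z hz)
        rw [hHe]
        change φ (u z) < _ at h1
        rcases h with h | h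
        · rw [h] at h1 ⊢
          linarith [mul_zero a, show a * (-m + m) = 0 by ring]
        · rw [h] at h1 ⊢
          linarith)
      (by
        intro z hz h1 h2
        have h3 := hin z (hball1 z hz.le)
        change φ (u z) < _ at h3
        have h4 := hP₀ (u z) ⟨h1, h2⟩
        rw [Real.norm_eq_abs] at h4
        have h5 := le_abs_self (a * (u z + m) + φ (-m) - φ (u z))
        have h6 := le_abs_self P₀
        rw [hHe]
        linarith)
      ⟨z, hz, by
        by_cases h : -m - 1 < u z
        · exact Or.inr (hz' h)
        · exact Or.inl (not_lt.1 h)⟩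
    rw [hHe] at this
    simp only [hu, zero_div] at this
    have h1 := le_abs_self (y + 1 - φ (-m))
    have h2 : a * 1 ≤ a * ((f 0).1.re + m) := mul_le_mul_of_nonneg_left (by linarith) ha0.le
    linarith
  have hsmall2 : ∀ z ∈ ball (0 : ℂ) (d / 2),
      (-m - 1 < (f z).1.re ∧ (f z).1.re < K + 1) ∧ φ (f z).1.re < (f z).2.re := by
    intro z hz
    have hz' : ‖z‖ < d / 2 := by simpa using hz
    have h1 := hsmall (2 * z) (by simp; linarith)
    have e : (2 * z) / 2 = z := by ring
    simp only [hu, e] at h1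
    exact ⟨h1, (htube _).1 (hmaps (by simp; linarith))⟩
  have hsub : ball (0 : ℂ) (d / 2) ⊆ ball 0 1 := ball_subset_ball (by linarith)
  have hy1 := le_abs_self y
  have hcn := abs_nonneg C₀
  have hyn := abs_nonneg y
  have hxn := abs_nonneg x
  have b1 : ‖deriv (fun z => (f z).1) 0‖ ≤ 8 * C / (d / 2) := by
    refine deriv_bound (by positivity) hCp (hg.mono hsub) (fun z hz => ?_) ?_
    · have := (hsmall2 z hz).1.1
      linarith
    · linarith
  have b2 : ‖deriv (fun z => (f z).2) 0‖ ≤ 8 * C / (d / 2) := by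
    refine deriv_bound (by positivity) hCp (hh.mono hsub) (fun z hz => ?_) ?_
    · obtain ⟨⟨h1, h2⟩, h3⟩ := hsmall2 z hz
      have h4 := hC₀ _ ⟨h1.le, h2.le⟩
      rw [Real.norm_eq_abs] at h4
      have h5 := neg_abs_le (φ (f z).1.re)
      have h6 := le_abs_self C₀
      linarith
    · linarith
  have h0 : ball (0 : ℂ) 1 ∈ 𝓝 (0 : ℂ) := ball_mem_nhds 0 one_pos
  have hfd : HasFDerivAt f ((fderiv ℂ (fun z => (f z).1) 0).prod
      (fderiv ℂ (fun z => (f z).2) 0)) 0 :=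
    (hg.differentiableAt h0).hasFDerivAt.prodMk (hh.differentiableAt h0).hasFDerivAt
  rw [hfd.fderiv]
  refine lt_of_le_of_lt ?_ (lt_add_one _)
  refine ContinuousLinearMap.opNorm_le_bound _ (by positivity) fun z => ?_
  rw [ContinuousLinearMap.prod_apply, Prod.norm_def]
  refine max_le ?_ ?_
  · refine (ContinuousLinearMap.le_opNorm _ z).trans ?_
    rw [← norm_deriv_eq_norm_fderiv]
    exact mul_le_mul_of_nonneg_right b1 (norm_nonneg _)
  · refine (ContinuousLinearMap.le_opNorm _ z).trans ?_
    rw [← norm_deriv_eq_norm_fderiv]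
    exact mul_le_mul_of_nonneg_right b2 (norm_nonneg _)
end

section
/- Let α>0, t>0 and e^{−2πα}·t < s < t. Then for every point w in the tube domain T_{C_{α,s,t}} ⊂ ℂ² there exist a neighborhood U of w in T_{C_{α,s,t}} and a constant M>0 such that every holomorphic map f: Δ → T_{C_{α,s,t}} with f(0) ∈ U satisfies ‖f'(0)‖ < M. (This derivative-bound condition characterizes Kobayashi hyperbolicity of T_{C_{α,s,t}}.) -/
open Complex Metric Set Filter Topology

/-- The base domain `C_{α,s,t}`: in polar coordinates, `s·e^{αφ} < r < t·e^{αφ}`. -/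
def setC (α s t : ℝ) : Set (ℝ × ℝ) :=
  {x | ∃ r φ : ℝ, s * Real.exp (α * φ) < r ∧ r < t * Real.exp (α * φ) ∧
       x = (r * Real.cos φ, r * Real.sin φ)}

/-- Lower bound for the modulus of the auxiliary function near the imaginary axis. -/
lemma aux_lower (a : ℝ) (ha : 0 < a) (l b : ℂ) (hb : b.re = a) (h0 : 0 ≤ l.re)
    (h1 : l.re ≤ a / 2) :
    1 ≤ ‖(l - b) / (l + (starRingEnd ℂ) b) * Complex.exp (((4 / a : ℝ) : ℂ) * l)‖ := by
  rw [norm_mul, norm_div, Complex.norm_exp]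
  have hre : (((4 / a : ℝ) : ℂ) * l).re = 4 / a * l.re := by simp [Complex.mul_re]
  rw [hre]
  set x := l.re with hx
  have hexp : 1 + 4 / a * x ≤ Real.exp (4 / a * x) := by
    linarith [Real.add_one_le_exp (4 / a * x)]
  have hq : (a - x) / (a + x) ≤ ‖l - b‖ / ‖l + (starRingEnd ℂ) b‖ := by
    have hn1 : ‖l - b‖ ^ 2 = (x - a) ^ 2 + (l.im - b.im) ^ 2 := by
      rw [← Complex.normSq_eq_norm_sq, Complex.normSq_apply]; simp [hb, ← hx]; ring
    have hn2 : ‖l + (starRingEnd ℂ) b‖ ^ 2 = (x + a) ^ 2 + (l.im - b.im) ^ 2 := by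
      rw [← Complex.normSq_eq_norm_sq, Complex.normSq_apply]; simp [hb, ← hx]; ring
    have hpos : 0 < ‖l + (starRingEnd ℂ) b‖ := by
      have : 0 < ‖l + (starRingEnd ℂ) b‖ ^ 2 := by rw [hn2]; positivity
      exact lt_of_le_of_ne (norm_nonneg _) (fun h => by rw [← h] at this; norm_num at this)
    rw [div_le_div_iff₀ (by linarith) hpos]
    refine (sq_le_sq₀ (by first | positivity | exact mul_nonneg (by linarith) (norm_nonneg _)) (by positivity)).1 ?_
    rw [mul_pow, mul_pow, hn1, hn2]
    have : (a - x) ^ 2 ≤ (a + x) ^ 2 := by nlinarith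
    nlinarith [mul_le_mul_of_nonneg_right this (sq_nonneg (l.im - b.im))]
  have hq0 : 0 ≤ (a - x) / (a + x) := div_nonneg (by linarith) (by linarith)
  calc (1 : ℝ) ≤ (a - x) / (a + x) * (1 + 4 / a * x) := by
        rw [div_mul_eq_mul_div, le_div_iff₀ (by linarith)]
        have : (a - x) * (1 + 4 / a * x) - (a + x) = 4 * x / a * (a / 2 - x) := by
          field_simp; ring
        have h2 : 0 ≤ 4 * x / a * (a / 2 - x) :=
          mul_nonneg (by positivity) (by linarith)
        linarith
    _ ≤ _ := mul_le_mul hq hexp (by positivity) (by positivity)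

lemma aux_upper (a M : ℝ) (ha : 0 < a) (l b : ℂ) (hb : b.re = a) (h0 : 0 ≤ l.re)
    (h1 : l.re ≤ M) :
    ‖(l - b) / (l + (starRingEnd ℂ) b) * Complex.exp (((4 / a : ℝ) : ℂ) * l)‖
      ≤ Real.exp (4 / a * M) := by
  rw [norm_mul, norm_div, Complex.norm_exp]
  have hre : (((4 / a : ℝ) : ℂ) * l).re = 4 / a * l.re := by simp [Complex.mul_re]
  rw [hre]
  have hq : ‖l - b‖ / ‖l + (starRingEnd ℂ) b‖ ≤ 1 := by
    apply div_le_one_of_le₀ _ (norm_nonneg _)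
    refine (sq_le_sq₀ (by first | positivity | exact mul_nonneg (by linarith) (norm_nonneg _)) (by positivity)).1 ?_
    rw [← Complex.normSq_eq_norm_sq, ← Complex.normSq_eq_norm_sq, Complex.normSq_apply,
      Complex.normSq_apply]
    simp [hb]
    nlinarith
  have he : Real.exp (4 / a * l.re) ≤ Real.exp (4 / a * M) := by
    apply Real.exp_le_exp.2; gcongr
  calc _ ≤ 1 * Real.exp (4 / a * M) := mul_le_mul hq he (by positivity) (by norm_num)
    _ = _ := one_mul _

/-- The key maximum-principle estimate. -/
lemma core_s2 (l : ℂ → ℂ) (V : Set ℂ) (M : ℝ) (hl : DifferentiableOn ℂ l (ball (0 : ℂ) 1))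
    (hV : IsOpen V) (hV1 : V ⊆ ball (0 : ℂ) 1) (h0 : (0 : ℂ) ∈ V)
    (hpos : ∀ ζ ∈ V, 0 < (l ζ).re ∧ (l ζ).re ≤ M)
    (hfr : ∀ ζ ∈ ball (0 : ℂ) 1, ζ ∈ closure V → ζ ∉ V → (l ζ).re = 0) :
    ‖deriv l 0‖ ≤ 4 * (l 0).re * Real.exp (4 / (l 0).re * M) := by
  obtain ⟨a, hadef⟩ : ∃ a, a = (l 0).re := ⟨_, rfl⟩
  obtain ⟨b, hbdef⟩ : ∃ b, b = l 0 := ⟨_, rfl⟩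
  have ha : 0 < a := hadef ▸ (hpos 0 h0).1
  have haM : a ≤ M := hadef ▸ (hpos 0 h0).2
  have hb : b.re = a := by rw [hbdef, hadef]
  rw [← hadef]
  set g : ℂ → ℂ := fun ζ => (l ζ - b) / (l ζ + (starRingEnd ℂ) b) *
    Complex.exp (((4 / a : ℝ) : ℂ) * l ζ) with hg
  have hlc : ContinuousOn l (ball (0 : ℂ) 1) := hl.continuousOn
  have hrec : ContinuousOn (fun ζ => (l ζ).re) (ball (0 : ℂ) 1) :=
    Complex.continuous_re.comp_continuousOn hlc
  -- the open set where the auxiliary function is holomorphic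
  set N : Set ℂ := ball (0 : ℂ) 1 ∩ (fun ζ => (l ζ).re) ⁻¹' (Ioi (-a)) with hN
  have hNo : IsOpen N := hrec.isOpen_inter_preimage isOpen_ball isOpen_Ioi
  have hden : ∀ ζ ∈ N, l ζ + (starRingEnd ℂ) b ≠ 0 := by
    intro ζ hζ h
    have h2 := congrArg Complex.re h
    have h3 : -a < (l ζ).re := hζ.2
    simp [hb] at h2
    linarith
  have hlN : DifferentiableOn ℂ l N := hl.mono inter_subset_left
  have hgN : DifferentiableOn ℂ g N := by
    apply DifferentiableOn.mul
    · exact (hlN.sub_const b).div (hlN.add_const _) hden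
    · exact (hlN.const_mul _).cexp
  have h0N : (0 : ℂ) ∈ N := ⟨hV1 h0, by
    have := (hpos 0 h0).1
    simp only [mem_preimage, mem_Ioi]; linarith⟩
  have hGN : DifferentiableOn ℂ (dslope g 0) N :=
    (Complex.differentiableOn_dslope (hNo.mem_nhds h0N)).2 hgN
  have hg0 : g 0 = 0 := by simp [hg, hbdef]
  have hGne : ∀ ζ, ζ ≠ 0 → ‖dslope g 0 ζ‖ = ‖g ζ‖ / ‖ζ‖ := by
    intro ζ hζ
    rw [dslope_of_ne _ hζ, slope_def_field, hg0, sub_zero, sub_zero, norm_div]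
  -- behaviour on the closure
  have hcl : ∀ ζ ∈ ball (0 : ℂ) 1, ζ ∈ closure V → 0 ≤ (l ζ).re ∧ (l ζ).re ≤ M := by
    intro ζ hζ hζV
    by_cases h : ζ ∈ V
    · exact ⟨(hpos ζ h).1.le, (hpos ζ h).2⟩
    · rw [hfr ζ hζ hζV h]; exact ⟨le_rfl, by linarith⟩
  set W : Set ℂ := V ∩ ball (0 : ℂ) (1 / 2) with hW
  have hWo : IsOpen W := hV.inter isOpen_ball
  have h0W : (0 : ℂ) ∈ W := ⟨h0, by simp⟩
  have hWb : Bornology.IsBounded W := isBounded_ball.subset inter_subset_right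
  have hclW : ∀ ζ ∈ closure W, ζ ∈ closure V ∧ ‖ζ‖ ≤ 1 / 2 := by
    intro ζ hζ
    refine ⟨closure_mono inter_subset_left hζ, ?_⟩
    have := closure_ball_subset_closedBall (closure_mono (inter_subset_right (s := V)) hζ)
    simpa using this
  have hball : ∀ ζ : ℂ, ‖ζ‖ ≤ 1 / 2 → ζ ∈ ball (0 : ℂ) 1 := by
    intro ζ h; rw [mem_ball_zero_iff]; linarith
  have hclWN : closure W ⊆ N := by
    intro ζ hζ
    obtain ⟨h1, h2⟩ := hclW ζ hζ
    refine ⟨hball ζ h2, ?_⟩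
    have := (hcl ζ (hball ζ h2) h1).1
    simp only [mem_preimage, mem_Ioi]; linarith
  have hd : DiffContOnCl ℂ (dslope g 0) W := (hGN.mono hclWN).diffContOnCl
  obtain ⟨z, hzf, hzmax⟩ := Complex.exists_mem_frontier_isMaxOn_norm hWb ⟨0, h0W⟩ hd
  have hzW : z ∈ closure W := frontier_subset_closure hzf
  have hznW : z ∉ W := by
    rw [hWo.frontier_eq] at hzf; exact hzf.2
  obtain ⟨hzV, hz2⟩ := hclW z hzW
  have hz0 : z ≠ 0 := fun h => hznW (h ▸ h0W)
  have hmax0 : ‖dslope g 0 0‖ ≤ ‖dslope g 0 z‖ := hzmax (subset_closure h0W)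
  have hkey : ‖dslope g 0 z‖ ≤ 2 * Real.exp (4 / a * M) := by
    rcases hz2.eq_or_lt with hz2 | hz2
    · rw [hGne z hz0, hz2]
      have := aux_upper a M ha (l z) b hb (hcl z (hball z hz2.le) hzV).1
        (hcl z (hball z hz2.le) hzV).2
      have h2 : ‖g z‖ ≤ Real.exp (4 / a * M) := this
      linarith
    · exfalso
      have hznV : z ∉ V := fun h => hznW ⟨h, by simpa using hz2⟩
      have hgz : ‖g z‖ ≤ 1 := by
        have hr := hfr z (hball z hz2.le) hzV hznV
        have := aux_upper a 0 ha (l z) b hb hr.ge hr.le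
        rw [mul_zero, Real.exp_zero] at this
        exact this
      -- the point of the complement closest to the origin
      have hEc : IsCompact (closedBall (0 : ℂ) (1 / 2) \ V) :=
        (isCompact_closedBall _ _).diff hV
      obtain ⟨e, heE, hemin⟩ := hEc.exists_isMinOn ⟨z, by simpa using hz2.le, hznV⟩
        (continuous_norm.continuousOn)
      have hez : ‖e‖ ≤ ‖z‖ := hemin (show z ∈ closedBall (0 : ℂ) (1 / 2) \ V from
        ⟨by simpa using hz2.le, hznV⟩)
      have he0 : e ≠ 0 := fun h => heE.2 (h ▸ h0)
      have hepos : 0 < ‖e‖ := norm_pos_iff.2 he0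
      have he1 : e ∈ ball (0 : ℂ) 1 := hball e (by linarith)
      have hin : ∀ τ : ℝ, 0 < τ → τ < 1 → (τ : ℂ) * e ∈ V ∧ ‖(τ : ℂ) * e‖ < ‖e‖ := by
        intro τ h1 h2
        have hn : ‖(τ : ℂ) * e‖ < ‖e‖ := by
          rw [norm_mul, Complex.norm_real, Real.norm_of_nonneg h1.le]
          nlinarith
        refine ⟨?_, hn⟩
        by_contra hc
        have : ‖e‖ ≤ ‖(τ : ℂ) * e‖ := hemin
          (show (τ : ℂ) * e ∈ closedBall (0 : ℂ) (1 / 2) \ V from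
          ⟨by rw [mem_closedBall_zero_iff]; linarith, hc⟩)
        linarith
      have htend : Tendsto (fun τ : ℝ => (τ : ℂ) * e) (𝓝[<] 1) (𝓝 e) := by
        have : Continuous (fun τ : ℝ => (τ : ℂ) * e) := by fun_prop
        have h := this.tendsto 1
        simp only [Complex.ofReal_one, one_mul] at h
        exact h.mono_left nhdsWithin_le_nhds
      have hev01 : ∀ᶠ τ : ℝ in 𝓝[<] 1, 0 < τ ∧ τ < 1 := Ioo_mem_nhdsLT (by norm_num)
      have hecl : e ∈ closure V :=
        mem_closure_of_tendsto htend (hev01.mono fun τ h => (hin τ h.1 h.2).1)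
      have hle : (l e).re = 0 := hfr e he1 hecl heE.2
      have hlt : ∀ᶠ τ : ℝ in 𝓝[<] 1, (l ((τ : ℂ) * e)).re < a / 2 := by
        have hc := (hrec.continuousAt (isOpen_ball.mem_nhds he1)).tendsto.comp htend
        apply hc.eventually_lt_const
        simp only [hle]; linarith
      obtain ⟨τ, ⟨hτ0, hτ1⟩, hτl⟩ := (hev01.and hlt).exists
      obtain ⟨hτV, hτn⟩ := hin τ hτ0 hτ1
      have hτne : (τ : ℂ) * e ≠ 0 := mul_ne_zero (by exact_mod_cast hτ0.ne') he0
      have hτW : (τ : ℂ) * e ∈ W := ⟨hτV, by rw [mem_ball_zero_iff]; linarith⟩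
      have h1 : ‖dslope g 0 ((τ : ℂ) * e)‖ ≤ ‖dslope g 0 z‖ := hzmax (subset_closure hτW)
      rw [hGne _ hτne, hGne _ hz0] at h1
      have h2 : 1 ≤ ‖g ((τ : ℂ) * e)‖ :=
        aux_lower a ha _ b hb (hpos _ hτV).1.le hτl.le
      have hτpos : 0 < ‖(τ : ℂ) * e‖ := norm_pos_iff.2 hτne
      have hzpos : 0 < ‖z‖ := norm_pos_iff.2 hz0
      rw [div_le_div_iff₀ hτpos hzpos] at h1
      nlinarith
  -- compute the derivative
  have hlda : HasDerivAt l (deriv l 0) 0 :=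
    (hl.differentiableAt (isOpen_ball.mem_nhds (hV1 h0))).hasDerivAt
  have hq := (hlda.sub_const b).div (hlda.add_const ((starRingEnd ℂ) b)) (hden 0 h0N)
  have hgd := hq.mul (hlda.const_mul (((4 / a : ℝ) : ℂ))).cexp
  have hbb : b + (starRingEnd ℂ) b = ((2 * a : ℝ) : ℂ) := by
    rw [Complex.add_conj, hb]
  have hgd' : deriv g 0 = deriv l 0 / ((2 * a : ℝ) : ℂ) *
      Complex.exp (((4 / a : ℝ) : ℂ) * b) := by
    refine (HasDerivAt.deriv hgd).trans ?_
    have h2a : ((2 * a : ℝ) : ℂ) ≠ 0 := by exact_mod_cast (by positivity : (2 * a) ≠ 0)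
    simp only [Pi.div_apply, Pi.sub_apply, ← hbdef, hbb, sub_self, zero_div, zero_mul, add_zero, sub_zero]
    congr 1
    field_simp
  rw [dslope_same, hgd', norm_mul, norm_div, Complex.norm_real, Complex.norm_exp,
    Real.norm_of_nonneg (by positivity)] at hmax0
  have hre : (((4 / a : ℝ) : ℂ) * b).re = 4 := by
    simp [Complex.mul_re, hb]; field_simp
  rw [hre] at hmax0
  have h3 : ‖deriv l 0‖ / (2 * a) * 1 ≤ ‖deriv l 0‖ / (2 * a) * Real.exp 4 := by
    gcongr; exact Real.one_le_exp (by norm_num)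
  have h4 : ‖deriv l 0‖ / (2 * a) ≤ 2 * Real.exp (4 / a * M) := by linarith
  rw [div_le_iff₀ (by positivity)] at h4
  linarith

lemma polar_near (α s t r0 φ0 ε : ℝ) (hε : 0 < ε) (hr0 : 0 < r0)
    (h1 : s * Real.exp (α * φ0) < r0) (h2 : r0 < t * Real.exp (α * φ0)) :
    ∀ᶠ y : ℝ × ℝ in 𝓝 (r0 * Real.cos φ0, r0 * Real.sin φ0),
      ∃ r φ : ℝ, |φ - φ0| < ε ∧ s * Real.exp (α * φ) < r ∧ r < t * Real.exp (α * φ) ∧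
        y = (r * Real.cos φ, r * Real.sin φ) := by
  set x0 : ℝ × ℝ := (r0 * Real.cos φ0, r0 * Real.sin φ0) with hx0
  set Y : ℝ × ℝ → ℂ := fun y => ((y.1 : ℂ) + (y.2 : ℂ) * Complex.I) *
    Complex.exp (-((φ0 : ℂ) * Complex.I)) with hY
  have hYc : Continuous Y := by fun_prop
  have hYx : Y x0 = (r0 : ℂ) := by
    have : ((r0 * Real.cos φ0 : ℝ) : ℂ) + ((r0 * Real.sin φ0 : ℝ) : ℂ) * Complex.I
        = r0 * Complex.exp ((φ0 : ℂ) * Complex.I) := by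
      rw [Complex.exp_mul_I]; push_cast; ring
    simp only [hY, hx0]
    rw [this, mul_assoc, ← Complex.exp_add, add_neg_cancel, Complex.exp_zero, mul_one]
  have harg : ContinuousAt (fun y => φ0 + Complex.arg (Y y)) x0 := by
    have : ContinuousAt Complex.arg (Y x0) := by
      apply Complex.continuousAt_arg
      rw [hYx]; exact Complex.ofReal_mem_slitPlane.2 hr0
    exact continuousAt_const.add (ContinuousAt.comp this hYc.continuousAt)
  have hargx : φ0 + Complex.arg (Y x0) = φ0 := by
    rw [hYx, Complex.arg_ofReal_of_nonneg hr0.le, add_zero]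
  have hnx : ‖Y x0‖ = r0 := by
    rw [hYx, Complex.norm_real, Real.norm_of_nonneg hr0.le]
  have hn : ContinuousAt (fun y => ‖Y y‖) x0 := hYc.norm.continuousAt
  have hE : ∀ k : ℝ, ContinuousAt (fun y => k * Real.exp (α * (φ0 + Complex.arg (Y y)))) x0 := by
    intro k
    exact continuousAt_const.mul (Real.continuous_exp.continuousAt.comp (continuousAt_const.mul harg))
  have e1 : ∀ᶠ y in 𝓝 x0, |φ0 + Complex.arg (Y y) - φ0| < ε := by
    have : ContinuousAt (fun y => |φ0 + Complex.arg (Y y) - φ0|) x0 :=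
      (harg.sub continuousAt_const).abs
    apply this.tendsto.eventually_lt_const
    rw [hargx]; simpa using hε
  have e2 := (hE s).tendsto.eventually_lt hn.tendsto (by rw [hargx, hnx]; exact h1)
  have e3 := hn.tendsto.eventually_lt (hE t).tendsto (by rw [hargx, hnx]; exact h2)
  filter_upwards [e1, e2, e3] with y hy1 hy2 hy3
  refine ⟨_, _, hy1, hy2, hy3, ?_⟩
  have hid : (‖Y y‖ : ℂ) * Complex.exp (((φ0 + Complex.arg (Y y) : ℝ) : ℂ) * Complex.I)
      = (y.1 : ℂ) + (y.2 : ℂ) * Complex.I := by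
    have h := Complex.norm_mul_exp_arg_mul_I (Y y)
    rw [Complex.ofReal_add, add_mul, Complex.exp_add, mul_left_comm, h]
    simp only [hY]
    rw [mul_left_comm, ← Complex.exp_add, add_neg_cancel, Complex.exp_zero, mul_one]
  rw [Complex.exp_mul_I, ← Complex.ofReal_cos, ← Complex.ofReal_sin] at hid
  have hr := congrArg Complex.re hid
  have hi := congrArg Complex.im hid
  simp [-Complex.ofReal_cos, -Complex.ofReal_sin, -Complex.ofReal_add] at hr hi
  exact Prod.ext hr.symm hi.symm

lemma polar_unique_aux (α s t r φ ψ : ℝ) (hα : 0 < α) (hs : 0 < s)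
    (hst : Real.exp (-(2 * Real.pi * α)) * t < s) (k : ℤ) (hk : φ - ψ = 2 * Real.pi * k)
    (h1 : s * Real.exp (α * φ) < r) (h2 : r < t * Real.exp (α * ψ)) : k < 1 := by
  by_contra hc
  push Not at hc
  have hk1 : (1 : ℝ) ≤ k := by exact_mod_cast hc
  have hφ : 2 * Real.pi + ψ ≤ φ := by nlinarith [Real.pi_pos]
  have h3 : s * Real.exp (α * (2 * Real.pi + ψ)) < t * Real.exp (α * ψ) := by
    refine lt_of_le_of_lt ?_ (h1.trans h2)
    gcongr
  have h4 : Real.exp (-(2 * Real.pi * α)) * t * Real.exp (α * (2 * Real.pi + ψ))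
      = t * Real.exp (α * ψ) := by
    rw [mul_comm (Real.exp _) t, mul_assoc, ← Real.exp_add]; ring_nf
  have h5 := mul_lt_mul_of_pos_right hst (Real.exp_pos (α * (2 * Real.pi + ψ)))
  linarith

lemma polar_unique (α s t r φ r' ψ : ℝ) (hα : 0 < α) (hs : 0 < s)
    (hst : Real.exp (-(2 * Real.pi * α)) * t < s)
    (h1 : s * Real.exp (α * φ) < r) (h2 : r < t * Real.exp (α * φ))
    (h1' : s * Real.exp (α * ψ) < r') (h2' : r' < t * Real.exp (α * ψ))
    (he : (r * Real.cos φ, r * Real.sin φ) = (r' * Real.cos ψ, r' * Real.sin ψ)) : φ = ψ := by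
  have hr : 0 < r := lt_trans (by positivity) h1
  have hr' : 0 < r' := lt_trans (by positivity) h1'
  obtain ⟨hc, hsn⟩ := Prod.mk.inj he
  have hrr : r = r' := by
    have : r ^ 2 = r' ^ 2 := by
      have e1 := Real.cos_sq_add_sin_sq φ
      have e2 := Real.cos_sq_add_sin_sq ψ
      calc r ^ 2 = (r * Real.cos φ) ^ 2 + (r * Real.sin φ) ^ 2 := by linear_combination -(r ^ 2) * e1
        _ = (r' * Real.cos ψ) ^ 2 + (r' * Real.sin ψ) ^ 2 := by rw [hc, hsn]
        _ = r' ^ 2 := by linear_combination (r' ^ 2) * e2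
    exact (pow_left_inj₀ hr.le hr'.le two_ne_zero).1 this
  subst hrr
  have hc' := mul_left_cancel₀ hr.ne' hc
  have hs' := mul_left_cancel₀ hr.ne' hsn
  obtain ⟨k, hk⟩ := Real.Angle.angle_eq_iff_two_pi_dvd_sub.1 (Real.Angle.cos_sin_inj hc' hs')
  have k1 := polar_unique_aux α s t r φ ψ hα hs hst k hk h1 h2'
  have k2 := polar_unique_aux α s t r ψ φ hα hs hst (-k) (by push_cast; linarith) h1' h2
  have : k = 0 := by omega
  subst this
  simp at hk
  linarith

/-- The piece of the spiral with angle in `(c, c + π)`. -/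
def piece (α s t c : ℝ) : Set (ℝ × ℝ) :=
  {x | ∃ r φ : ℝ, c < φ ∧ φ < c + Real.pi ∧ s * Real.exp (α * φ) < r ∧
       r < t * Real.exp (α * φ) ∧ x = (r * Real.cos φ, r * Real.sin φ)}

lemma piece_subset (α s t c : ℝ) : piece α s t c ⊆ setC α s t := by
  rintro x ⟨r, φ, -, -, h1, h2, h3⟩
  exact ⟨r, φ, h1, h2, h3⟩

lemma piece_open (α s t c : ℝ) (hs : 0 < s) : IsOpen (piece α s t c) := by
  rw [isOpen_iff_mem_nhds]
  rintro x ⟨r, φ, hc1, hc2, h1, h2, rfl⟩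
  have hr : 0 < r := lt_trans (by positivity) h1
  filter_upwards [polar_near α s t r φ (min (φ - c) (c + Real.pi - φ))
    (lt_min (by linarith) (by linarith)) hr h1 h2] with y hy
  obtain ⟨r', ψ, hψ, h1', h2', rfl⟩ := hy
  obtain ⟨ha, hb⟩ := lt_min_iff.1 hψ
  rw [abs_lt] at ha hb
  exact ⟨r', ψ, by linarith, by linarith, h1', h2', rfl⟩

lemma piece_pos (α s t c : ℝ) (hα : 0 < α) (hs : 0 < s) (ht : 0 < t) (x : ℝ × ℝ)
    (hx : x ∈ piece α s t c) :
    0 < -Real.sin c * x.1 + Real.cos c * x.2 ∧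
    -Real.sin c * x.1 + Real.cos c * x.2 ≤ t * Real.exp (α * (c + Real.pi)) := by
  obtain ⟨r, φ, hc1, hc2, h1, h2, rfl⟩ := hx
  have hr : 0 < r := lt_trans (by positivity) h1
  have e : -Real.sin c * (r * Real.cos φ) + Real.cos c * (r * Real.sin φ)
      = r * Real.sin (φ - c) := by rw [Real.sin_sub]; ring
  simp only [e]
  refine ⟨mul_pos hr (Real.sin_pos_of_pos_of_lt_pi (by linarith) (by linarith)), ?_⟩
  calc r * Real.sin (φ - c) ≤ r * 1 := by gcongr; exact Real.sin_le_one _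
    _ ≤ t * Real.exp (α * φ) := by linarith
    _ ≤ _ := by gcongr

lemma piece_frontier (α s t c : ℝ) (hα : 0 < α) (hs : 0 < s)
    (hst : Real.exp (-(2 * Real.pi * α)) * t < s) (x : ℝ × ℝ) (hx : x ∈ setC α s t)
    (hxc : x ∈ closure (piece α s t c)) (hxn : x ∉ piece α s t c) :
    -Real.sin c * x.1 + Real.cos c * x.2 = 0 := by
  obtain ⟨r, φ, h1, h2, rfl⟩ := hx
  have hr : 0 < r := lt_trans (by positivity) h1
  have e : -Real.sin c * (r * Real.cos φ) + Real.cos c * (r * Real.sin φ)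
      = r * Real.sin (φ - c) := by rw [Real.sin_sub]; ring
  have near : ∀ ε > 0, ∃ ψ, |ψ - φ| < ε ∧ c < ψ ∧ ψ < c + Real.pi := by
    intro ε hε
    have hev := polar_near α s t r φ ε hε hr h1 h2
    obtain ⟨y, ⟨r1, ψ1, hψ, ha, hb, rfl⟩, ⟨r2, ψ2, hc1, hc2, ha', hb', he⟩⟩ :=
      mem_closure_iff_nhds.1 hxc _ hev
    have := polar_unique α s t r1 ψ1 r2 ψ2 hα hs hst ha hb ha' hb' he
    subst this
    exact ⟨ψ1, hψ, hc1, hc2⟩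
  have hge : c ≤ φ := by
    by_contra h
    obtain ⟨ψ, a1, a2, a3⟩ := near (c - φ) (by linarith)
    rw [abs_lt] at a1; linarith
  have hle : φ ≤ c + Real.pi := by
    by_contra h
    obtain ⟨ψ, a1, a2, a3⟩ := near (φ - (c + Real.pi)) (by linarith)
    rw [abs_lt] at a1; linarith
  simp only [e]
  rcases hge.eq_or_lt with h | h
  · simp [h]
  · rcases hle.eq_or_lt with h' | h'
    · simp [h']
    · exact absurd ⟨r, φ, h, h', h1, h2, rfl⟩ hxn

/-- Bound for one linear functional of the derivative. -/
lemma piece_bound (α s t c : ℝ) (hα : 0 < α) (hs : 0 < s) (ht : 0 < t)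
    (hst : Real.exp (-(2 * Real.pi * α)) * t < s) (w : ℂ × ℂ)
    (hw : w ∈ tube (piece α s t c)) :
    ∃ B > (0 : ℝ), ∀ᶠ z in 𝓝 w, ∀ f : ℂ → ℂ × ℂ, DifferentiableOn ℂ f (ball (0 : ℂ) 1) →
        MapsTo f (ball (0 : ℂ) 1) (tube (setC α s t)) → f 0 = z →
        ‖-(Real.sin c : ℂ) * (deriv f 0).1 + (Real.cos c : ℂ) * (deriv f 0).2‖ ≤ B := by
  set R : ℂ × ℂ → ℝ × ℝ := fun z => (z.1.re, z.2.re) with hR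
  have hRc : Continuous R := by fun_prop
  set L : ℂ × ℂ → ℝ := fun z => -Real.sin c * z.1.re + Real.cos c * z.2.re with hL
  have hLc : Continuous L := by fun_prop
  set M := t * Real.exp (α * (c + Real.pi)) with hM
  have hMpos : 0 < M := by positivity
  have hwp : 0 < L w := (piece_pos α s t c hα hs ht _ hw).1
  refine ⟨4 * (2 * L w) * Real.exp (4 / (L w / 2) * M), by positivity, ?_⟩
  have ev1 : ∀ᶠ z in 𝓝 w, R z ∈ piece α s t c :=
    hRc.continuousAt.eventually ((piece_open α s t c hs).mem_nhds hw)
  have ev2 : ∀ᶠ z in 𝓝 w, L z < 2 * L w :=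
    hLc.continuousAt.tendsto.eventually_lt_const (by linarith)
  have ev3 : ∀ᶠ z in 𝓝 w, L w / 2 < L z :=
    hLc.continuousAt.tendsto.eventually_const_lt (by linarith)
  filter_upwards [ev1, ev2, ev3] with z hz1 hz2 hz3 f hf hm hfz
  subst hfz
  set l : ℂ → ℂ := fun ζ => -(Real.sin c : ℂ) * (f ζ).1 + (Real.cos c : ℂ) * (f ζ).2 with hl
  have hlre : ∀ ζ, (l ζ).re = L (f ζ) := by
    intro ζ
    simp [hl, hL, -Complex.ofReal_cos, -Complex.ofReal_sin]
  have hld : DifferentiableOn ℂ l (ball (0 : ℂ) 1) :=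
    (hf.fst.const_mul _).add (hf.snd.const_mul _)
  set V : Set ℂ := ball (0 : ℂ) 1 ∩ (fun ζ => R (f ζ)) ⁻¹' piece α s t c with hV
  have hRf : ContinuousOn (fun ζ => R (f ζ)) (ball (0 : ℂ) 1) :=
    hRc.comp_continuousOn hf.continuousOn
  have hVo : IsOpen V := hRf.isOpen_inter_preimage isOpen_ball (piece_open α s t c hs)
  have hb := core_s2 l V M hld hVo inter_subset_left ⟨by simp, hz1⟩
    (by
      intro ζ hζ
      rw [hlre]
      exact piece_pos α s t c hα hs ht _ hζ.2)
    (by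
      intro ζ hζ hζc hζn
      rw [hlre]
      apply piece_frontier α s t c hα hs hst (R (f ζ)) (hm hζ)
      · have h1 := (hRf.continuousAt (isOpen_ball.mem_nhds hζ)).continuousWithinAt (s := V)
        exact closure_mono (image_subset_iff.2 fun y hy => hy.2) (h1.mem_closure_image hζc)
      · exact fun h => hζn ⟨hζ, h⟩)
  have hfd : HasDerivAt f (deriv f 0) 0 :=
    (hf.differentiableAt (isOpen_ball.mem_nhds (by simp))).hasDerivAt
  have hfd1 : HasDerivAt (fun ζ => (f ζ).1) (deriv f 0).1 0 := by
    simpa using (HasFDerivAt.fst hfd.hasFDerivAt).hasDerivAt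
  have hfd2 : HasDerivAt (fun ζ => (f ζ).2) (deriv f 0).2 0 := by
    simpa using (HasFDerivAt.snd hfd.hasFDerivAt).hasDerivAt
  have hlda : HasDerivAt l (-(Real.sin c : ℂ) * (deriv f 0).1 + (Real.cos c : ℂ) * (deriv f 0).2) 0 :=
    (hfd1.const_mul _).add (hfd2.const_mul _)
  rw [hlda.deriv, hlre] at hb
  refine hb.trans ?_
  have hLp : 0 < L (f 0) := by linarith
  gcongr

/-- The tube domain `T_{C_{α,s,t}}` is Kobayashi-hyperbolic: every point has a
neighborhood on which derivatives at `0` of holomorphic maps from the unit disk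
are uniformly bounded. -/
theorem tubeC_hyperbolic (α s t : ℝ) (hα : 0 < α) (ht : 0 < t)
    (hst : Real.exp (-(2 * Real.pi * α)) * t < s) (hst' : s < t)
    (w : ℂ × ℂ) (hw : w ∈ tube (setC α s t)) :
    ∃ U ⊆ tube (setC α s t), U ∈ 𝓝 w ∧ ∃ M > (0 : ℝ),
      ∀ f : ℂ → ℂ × ℂ, DifferentiableOn ℂ f (ball (0 : ℂ) 1) →
        MapsTo f (ball (0 : ℂ) 1) (tube (setC α s t)) → f 0 ∈ U →
          ‖fderiv ℂ f 0‖ < M := by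
  have hs : 0 < s := lt_trans (by positivity) hst
  have hπ := Real.pi_pos
  obtain ⟨r, φ, h1, h2, hwe⟩ := hw
  set c := φ - 3 * Real.pi / 4 with hc
  have hw1 : w ∈ tube (piece α s t c) := ⟨r, φ, by linarith, by linarith, h1, h2, hwe⟩
  have hw2 : w ∈ tube (piece α s t (c + Real.pi / 2)) :=
    ⟨r, φ, by linarith, by linarith, h1, h2, hwe⟩
  obtain ⟨B1, hB1, H1⟩ := piece_bound α s t c hα hs ht hst w hw1
  obtain ⟨B2, hB2, H2⟩ := piece_bound α s t _ hα hs ht hst w hw2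
  have hopen : tube (setC α s t) ∈ 𝓝 w := by
    have hRc : Continuous (fun z : ℂ × ℂ => (z.1.re, z.2.re)) := by fun_prop
    have h : tube (piece α s t c) ∈ 𝓝 w :=
      ((piece_open α s t c hs).preimage hRc).mem_nhds hw1
    exact mem_of_superset h fun z hz => piece_subset α s t c hz
  refine ⟨_, inter_subset_left, inter_mem hopen (inter_mem H1 H2), B1 + B2 + 1, by positivity, ?_⟩
  rintro f hf hm ⟨-, hf1, hf2⟩
  have b1 := hf1 f hf hm rfl
  have b2 := hf2 f hf hm rfl
  rw [Real.sin_add_pi_div_two, Real.cos_add_pi_div_two] at b2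
  rw [← norm_deriv_eq_norm_fderiv]
  set p := (deriv f 0).1 with hp
  set q := (deriv f 0).2 with hq
  set l1 := -(Real.sin c : ℂ) * p + (Real.cos c : ℂ) * q with hl1
  set l2 := -(Real.cos c : ℂ) * p + ((-Real.sin c : ℝ) : ℂ) * q with hl2
  have hsc : (Real.sin c : ℂ) ^ 2 + (Real.cos c : ℂ) ^ 2 = 1 := by
    exact_mod_cast Real.sin_sq_add_cos_sq c
  have ep : p = -(Real.sin c : ℂ) * l1 + -(Real.cos c : ℂ) * l2 := by
    rw [hl1, hl2]; push_cast [-Complex.ofReal_cos, -Complex.ofReal_sin]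
    linear_combination -p * hsc
  have eq : q = (Real.cos c : ℂ) * l1 + -(Real.sin c : ℂ) * l2 := by
    rw [hl1, hl2]; push_cast [-Complex.ofReal_cos, -Complex.ofReal_sin]
    linear_combination -q * hsc
  have ns : ‖(Real.sin c : ℂ)‖ ≤ 1 := by
    rw [Complex.norm_real]; exact Real.abs_sin_le_one c
  have nc : ‖(Real.cos c : ℂ)‖ ≤ 1 := by
    rw [Complex.norm_real]; exact Real.abs_cos_le_one c
  have comb : ∀ u v : ℂ, ‖u‖ ≤ 1 → ‖v‖ ≤ 1 → ‖u * l1 + v * l2‖ ≤ B1 + B2 := by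
    intro u v hu hv
    calc ‖u * l1 + v * l2‖ ≤ ‖u‖ * ‖l1‖ + ‖v‖ * ‖l2‖ := by
          rw [← norm_mul, ← norm_mul]; exact norm_add_le _ _
      _ ≤ 1 * B1 + 1 * B2 := by gcongr
      _ = _ := by ring
  have np : ‖p‖ ≤ B1 + B2 := by
    rw [ep]; exact comb _ _ (by rwa [norm_neg]) (by rwa [norm_neg])
  have nq : ‖q‖ ≤ B1 + B2 := by
    rw [eq]; exact comb _ _ nc (by rwa [norm_neg])
  have : ‖deriv f 0‖ ≤ B1 + B2 := by
    rw [Prod.norm_def]; exact max_le np nq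
  linarith
end
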